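/- Let G be a 6-edge-connected multigraph. Then G can be edge-decomposed into three spanning subgraphs G_1, G_2, G_3 such that for each vertex v and each i, |d_{G_i}(v) − d_G(v)/3| < 1, if and only if G does not have exactly one vertex whose degree is not divisible by 3. -/

import Mathlib

open Finset

variable {V E : Type*}

/-- Degree of `v` in the sub-multigraph given by the edge set `S`,
where `ends e` gives the two endpoints of edge `e` (loops count twice). -/
def mdeg [DecidableEq V] (ends : E → V × V) (S : Finset E) (v : V) : ℕ :=
  (S.filter fun e => (ends e).1 = v).card + (S.filter fun e => (ends e).2 = v).card

/-- Number of edges with exactly one end in the vertex set `X`. -/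
def cutCard [Fintype E] [DecidableEq V] (ends : E → V × V) (X : Finset V) : ℕ :=
  (univ.filter fun e : E =>
    ((ends e).1 ∈ X ∧ (ends e).2 ∉ X) ∨ ((ends e).1 ∉ X ∧ (ends e).2 ∈ X)).card

/-- `lam`-edge-connectedness: every edge cut has at least `lam` edges. -/
def EdgeConn [Fintype V] [Fintype E] [DecidableEq V] (ends : E → V × V) (lam : ℕ) : Prop :=
  ∀ X : Finset V, X.Nonempty → X ≠ univ → lam ≤ cutCard ends X


/-! ### Multisets of edges, cuts and orientations -/

section Basics

variable [DecidableEq V]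

/-- Indicator that an edge crosses `A`. -/
def cr (A : Finset V) : Sym2 V → ℤ :=
  Sym2.lift ⟨fun u v => if (u ∈ A ↔ v ∈ A) then 0 else 1, by
    intro u v
    by_cases h : u ∈ A <;> by_cases h' : v ∈ A <;> simp [h, h']⟩

theorem cr_mk (A : Finset V) (u v : V) :
    cr A s(u, v) = if (u ∈ A ↔ v ∈ A) then 0 else 1 := rfl

/-- Number of edges of `M` crossing `A`. -/
def cut (M : Multiset (Sym2 V)) (A : Finset V) : ℤ := (M.map (cr A)).sum

theorem cut_zero (A : Finset V) : cut (0 : Multiset (Sym2 V)) A = 0 := by simp [cut]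

theorem cut_cons (e : Sym2 V) (M : Multiset (Sym2 V)) (A : Finset V) :
    cut (e ::ₘ M) A = cr A e + cut M A := by simp [cut]

theorem cut_add (M M' : Multiset (Sym2 V)) (A : Finset V) :
    cut (M + M') A = cut M A + cut M' A := by simp [cut]

theorem cr_nonneg (A : Finset V) (e : Sym2 V) : 0 ≤ cr A e := by
  induction e using Sym2.ind with
  | _ u v => rw [cr_mk]; split_ifs <;> simp

theorem cut_nonneg (M : Multiset (Sym2 V)) (A : Finset V) : 0 ≤ cut M A := by
  induction M using Multiset.induction_on with
  | empty => simp [cut_zero]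
  | cons e M ih => rw [cut_cons]; have := cr_nonneg A e; omega

theorem cut_congr (M : Multiset (Sym2 V)) (A B : Finset V)
    (h : ∀ e ∈ M, cr A e = cr B e) : cut M A = cut M B := by
  unfold cut
  rw [Multiset.map_congr rfl h]

theorem cut_eq_zero (M : Multiset (Sym2 V)) (A : Finset V)
    (h : ∀ e ∈ M, cr A e = 0) : cut M A = 0 := by
  unfold cut
  rw [Multiset.map_congr rfl h]; simp

/-- Unit vector. -/
def dl (u : V) : V → ℤ := Pi.single u 1

theorem dl_apply (u v : V) : dl u v = if v = u then 1 else 0 := by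
  simp [dl, Pi.single_apply]

/-- Net out-degree vector of a multiset of arcs. -/
def net (L : Multiset (V × V)) : V → ℤ := (L.map fun p => dl p.1 - dl p.2).sum

/-- `c` is the net out-degree vector of some orientation of `M`. -/
def Orn (M : Multiset (Sym2 V)) (c : V → ℤ) : Prop :=
  ∃ L : Multiset (V × V), L.map (fun p => s(p.1, p.2)) = M ∧ net L = c

theorem Orn_zero : Orn (0 : Multiset (Sym2 V)) 0 := ⟨0, by simp, by simp [net]⟩

theorem Orn_zero_iff (c : V → ℤ) : Orn (0 : Multiset (Sym2 V)) c ↔ c = 0 := by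
  constructor
  · rintro ⟨L, hL, rfl⟩
    have : L = 0 := by simpa using hL
    subst this; simp [net]
  · rintro rfl; exact Orn_zero

theorem Orn_cons {M : Multiset (Sym2 V)} {c : V → ℤ} (u v : V) (h : Orn M c) :
    Orn (s(u, v) ::ₘ M) (c + dl u - dl v) := by
  obtain ⟨L, rfl, rfl⟩ := h
  refine ⟨(u, v) ::ₘ L, by simp, ?_⟩
  simp [net]; abel

theorem Orn_cons' {M : Multiset (Sym2 V)} {c : V → ℤ} (u v : V) (h : Orn M c) :
    Orn (s(u, v) ::ₘ M) (c + dl v - dl u) := by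
  rw [Sym2.eq_swap]; exact Orn_cons v u h

theorem Orn_cons_iff {M : Multiset (Sym2 V)} {c : V → ℤ} (u v : V) :
    Orn (s(u, v) ::ₘ M) c ↔ ∃ c0, Orn M c0 ∧ (c = c0 + dl u - dl v ∨ c = c0 + dl v - dl u) := by
  constructor
  · rintro ⟨L, hL, rfl⟩
    obtain ⟨a, ha, hau, haM⟩ := (Multiset.map_eq_cons _ _ _ _).2 hL
    obtain ⟨L', rfl⟩ := Multiset.exists_cons_of_mem ha
    refine ⟨net L', ⟨L', by simpa using haM, rfl⟩, ?_⟩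
    simp only [net, Multiset.map_cons, Multiset.sum_cons]
    rcases a with ⟨a1, a2⟩
    simp only [Sym2.eq_iff] at hau
    rcases hau with ⟨rfl, rfl⟩ | ⟨rfl, rfl⟩
    · left; abel
    · right; abel
  · rintro ⟨c0, h, rfl | rfl⟩
    · exact Orn_cons u v h
    · exact Orn_cons' u v h

theorem Orn_add {M M' : Multiset (Sym2 V)} {c c' : V → ℤ} (h : Orn M c) (h' : Orn M' c') :
    Orn (M + M') (c + c') := by
  obtain ⟨L, rfl, rfl⟩ := h
  obtain ⟨L', rfl, rfl⟩ := h'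
  exact ⟨L + L', by simp, by simp [net]⟩

theorem Orn_split {M M' : Multiset (Sym2 V)} : ∀ {c : V → ℤ}, Orn (M + M') c →
    ∃ c1 c2, c = c1 + c2 ∧ Orn M c1 ∧ Orn M' c2 := by
  induction M using Multiset.induction_on with
  | empty => intro c h; exact ⟨0, c, by simp, Orn_zero, by simpa using h⟩
  | cons e M ih =>
    induction e using Sym2.ind with
    | _ u v =>
      intro c h
      rw [Multiset.cons_add, Orn_cons_iff] at h
      obtain ⟨c0, h0, hc⟩ := h
      obtain ⟨c1, c2, rfl, h1, h2⟩ := ih h0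
      rcases hc with rfl | rfl
      · exact ⟨c1 + dl u - dl v, c2, by abel, Orn_cons u v h1, h2⟩
      · exact ⟨c1 + dl v - dl u, c2, by abel, Orn_cons' u v h1, h2⟩

theorem Orn_supp {M : Multiset (Sym2 V)} {v : V} : ∀ {c : V → ℤ}, Orn M c →
    (∀ e ∈ M, v ∉ e) → c v = 0 := by
  induction M using Multiset.induction_on with
  | empty => intro c h _; rw [Orn_zero_iff] at h; simp [h]
  | cons e M ih =>
    induction e using Sym2.ind with
    | _ a b =>
      intro c h hv
      rw [Orn_cons_iff] at h
      obtain ⟨c0, h0, hc⟩ := h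
      have h1 := ih h0 (fun e he => hv e (by simp [he]))
      have h2 := hv s(a, b) (by simp)
      simp only [Sym2.mem_iff, not_or] at h2
      rcases hc with rfl | rfl <;> simp [dl_apply, h1, h2]

theorem Orn_loop {M : Multiset (Sym2 V)} {c : V → ℤ} (x : V) (h : Orn M c) :
    Orn (s(x, x) ::ₘ M) c := by
  have := Orn_cons x x h
  simpa using this

theorem Orn_loops {M : Multiset (Sym2 V)} {c : V → ℤ} (K : Multiset (Sym2 V))
    (hK : ∀ e ∈ K, ∃ x, e = s(x, x)) (h : Orn M c) : Orn (K + M) c := by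
  induction K using Multiset.induction_on with
  | empty => simpa using h
  | cons e K ih =>
    obtain ⟨x, rfl⟩ := hK e (by simp)
    rw [Multiset.cons_add]
    exact Orn_loop x (ih (fun e he => hK e (by simp [he])))

theorem Orn_lift {M : Multiset (Sym2 V)} {c : V → ℤ} (x y w : V) (h : Orn (s(y, w) ::ₘ M) c) :
    Orn (s(x, y) ::ₘ s(x, w) ::ₘ M) c := by
  rw [Orn_cons_iff] at h
  obtain ⟨c0, h0, rfl | rfl⟩ := h
  · have := Orn_cons' x y (Orn_cons x w h0)
    convert this using 1; abel
  · have := Orn_cons x y (Orn_cons' x w h0)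
    convert this using 1; abel

theorem Orn_map [Fintype V] (φ : V → V) {M : Multiset (Sym2 V)} : ∀ {c' : V → ℤ},
    Orn (M.map (Sym2.map φ)) c' →
    ∃ c, Orn M c ∧ ∀ w, c' w = ∑ v ∈ univ.filter (fun v => φ v = w), c v := by
  have key : ∀ u w : V, ∑ v ∈ univ.filter (fun v => φ v = w), dl u v = dl (φ u) w := by
    intro u w
    simp only [dl_apply, Finset.sum_filter]
    rw [Finset.sum_eq_single u]
    · by_cases h : φ u = w
      · simp [h]
      · simp [h, Ne.symm h]
    · intro b _ hb; simp [hb]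
    · simp
  induction M using Multiset.induction_on with
  | empty =>
    intro c' h
    rw [Multiset.map_zero, Orn_zero_iff] at h
    exact ⟨0, Orn_zero, by simp [h]⟩
  | cons e M ih =>
    induction e using Sym2.ind with
    | _ a b =>
      intro c' h
      rw [Multiset.map_cons, Sym2.map_mk, Orn_cons_iff] at h
      obtain ⟨c0, h0, hc⟩ := h
      obtain ⟨c, h1, h2⟩ := ih h0
      rcases hc with rfl | rfl
      · refine ⟨_, Orn_cons a b h1, fun w => ?_⟩
        simp only [Pi.add_apply, Pi.sub_apply, Finset.sum_sub_distrib, Finset.sum_add_distrib, key, h2]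
      · refine ⟨_, Orn_cons' a b h1, fun w => ?_⟩
        simp only [Pi.add_apply, Pi.sub_apply, Finset.sum_sub_distrib, Finset.sum_add_distrib, key, h2]

theorem cut_map [Fintype V] (φ : V → V) (M : Multiset (Sym2 V)) (B : Finset V) :
    cut (M.map (Sym2.map φ)) B = cut M (univ.filter (fun v => φ v ∈ B)) := by
  unfold cut
  rw [Multiset.map_map]
  congr 1
  apply Multiset.map_congr rfl
  intro e _
  induction e using Sym2.ind with
  | _ a b => simp [cr_mk]

theorem cut_inter (M : Multiset (Sym2 V)) (S A B : Finset V)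
    (hS : ∀ e ∈ M, ∀ v ∈ e, v ∈ S) (h : ∀ v ∈ S, v ∈ A ↔ v ∈ B) : cut M A = cut M B := by
  apply cut_congr
  intro e he
  have h1 := hS e he
  induction e using Sym2.ind with
  | _ a b =>
    have ha := h a (h1 a (by simp))
    have hb := h b (h1 b (by simp))
    simp [cr_mk, ha, hb]

theorem cut_compl (M : Multiset (Sym2 V)) (S A : Finset V)
    (hS : ∀ e ∈ M, ∀ v ∈ e, v ∈ S) : cut M (S \ A) = cut M A := by
  apply cut_congr
  intro e he
  have h1 := hS e he
  induction e using Sym2.ind with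
  | _ a b =>
    have ha := (h1 a (by simp))
    have hb := (h1 b (by simp))
    simp [cr_mk, ha, hb, not_iff_not]

/-- Decomposition of the edge set at `x`. -/
theorem star (M : Multiset (Sym2 V)) (x : V) :
    ∃ (Y : Multiset V) (K R : Multiset (Sym2 V)), M = Y.map (fun y => s(x, y)) + K + R ∧
      x ∉ Y ∧ (∀ e ∈ K, e = s(x, x)) ∧ (∀ e ∈ R, x ∉ e) := by
  induction M using Multiset.induction_on with
  | empty => exact ⟨0, 0, 0, by simp⟩
  | cons e M ih =>
    obtain ⟨Y, K, R, rfl, hY, hK, hR⟩ := ih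
    by_cases hx : x ∈ e
    · obtain ⟨y, rfl⟩ := hx
      by_cases hxy : y = x
      · subst hxy
        refine ⟨Y, s(y, y) ::ₘ K, R, by simp, hY, ?_, hR⟩
        intro e he
        rcases Multiset.mem_cons.1 he with rfl | he
        · rfl
        · exact hK e he
      · refine ⟨y ::ₘ Y, K, R, by simp, ?_, hK, hR⟩
        simp [hY, Ne.symm hxy]
    · refine ⟨Y, K, e ::ₘ R, by simp, hY, hK, ?_⟩
      intro e' he
      rcases Multiset.mem_cons.1 he with rfl | he
      · exact hx
      · exact hR e' he

theorem count_star (Y : Multiset V) (K R : Multiset (Sym2 V)) (x y : V)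
    (hxy : y ≠ x) (hK : ∀ e ∈ K, e = s(x, x)) (hR : ∀ e ∈ R, x ∉ e) :
    (Y.map (fun y => s(x, y)) + K + R).count s(x, y) = Y.count y := by
  have h1 : K.count s(x, y) = 0 := by
    rw [Multiset.count_eq_zero]
    intro h
    have := hK _ h
    simp only [Sym2.eq_iff] at this
    rcases this with ⟨_, h⟩ | ⟨_, h⟩ <;> exact hxy h
  have h2 : R.count s(x, y) = 0 := by
    rw [Multiset.count_eq_zero]
    intro h
    exact hR _ h (by simp)
  rw [Multiset.count_add, Multiset.count_add, h1, h2]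
  have := Multiset.count_map_eq_count' (fun y => s(x, y)) Y (fun a b h => by simp only [Sym2.eq_iff] at h; grind) y
  simpa using this

/-- Neat form of the star decomposition for vertices without parallel edges. -/
theorem star_finset (M : Multiset (Sym2 V)) (x : V)
    (hs : ∀ y, y ≠ x → M.count s(x, y) ≤ 1) :
    ∃ (Y : Finset V) (K R : Multiset (Sym2 V)), M = Y.val.map (fun y => s(x, y)) + K + R ∧
      x ∉ Y ∧ (∀ e ∈ K, e = s(x, x)) ∧ (∀ e ∈ R, x ∉ e) := by
  obtain ⟨Y, K, R, rfl, hY, hK, hR⟩ := star M x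
  have hnd : Y.Nodup := by
    rw [Multiset.nodup_iff_count_le_one]
    intro y
    by_cases hxy : y = x
    · subst hxy; rw [Multiset.count_eq_zero.2 hY]; simp
    · rw [← count_star Y K R x y hxy hK hR]; exact hs y hxy
  exact ⟨⟨Y, hnd⟩, K, R, rfl, hY, hK, hR⟩

theorem cut_loops (K : Multiset (Sym2 V)) (x : V) (hK : ∀ e ∈ K, e = s(x, x)) (A : Finset V) :
    cut K A = 0 := by
  apply cut_eq_zero
  intro e he
  rw [hK e he, cr_mk]; simp

theorem cut_starY (Y : Finset V) (x : V) (A : Finset V) (hx : x ∉ A) :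
    cut (Y.val.map (fun y => s(x, y))) A = ((Y ∩ A).card : ℤ) := by
  unfold cut
  rw [Multiset.map_map]
  change ∑ y ∈ Y, cr A s(x, y) = _
  simp only [cr_mk, hx, false_iff, ite_not]
  rw [Finset.sum_ite_mem]; simp

theorem cut_starY' (Y : Finset V) (x : V) (A : Finset V) (hx : x ∈ A) :
    cut (Y.val.map (fun y => s(x, y))) A = (Y.card : ℤ) - ((Y ∩ A).card : ℤ) := by
  unfold cut
  rw [Multiset.map_map]
  change ∑ y ∈ Y, cr A s(x, y) = _
  have : ∀ y ∈ Y, cr A s(x, y) = 1 - (if y ∈ A then 1 else 0) := by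
    intro y _
    simp only [cr_mk, hx, true_iff]
    split_ifs <;> simp
  rw [Finset.sum_congr rfl this, Finset.sum_sub_distrib, Finset.sum_ite_mem]; simp

/-- Cut inequalities. -/
theorem cut_submod (M : Multiset (Sym2 V)) (A B : Finset V) :
    cut M (A ∩ B) + cut M (A ∪ B) ≤ cut M A + cut M B := by
  induction M using Multiset.induction_on with
  | empty => simp [cut_zero]
  | cons e M ih =>
    have : cr (A ∩ B) e + cr (A ∪ B) e ≤ cr A e + cr B e := by
      induction e using Sym2.ind with
      | _ u v =>
        simp only [cr_mk, Finset.mem_inter, Finset.mem_union]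
        by_cases h1 : u ∈ A <;> by_cases h2 : u ∈ B <;> by_cases h3 : v ∈ A <;>
          by_cases h4 : v ∈ B <;> simp [h1, h2, h3, h4]
    simp only [cut_cons]; omega

theorem cut_posimod (M : Multiset (Sym2 V)) (A B : Finset V) :
    cut M (A \ B) + cut M (B \ A) ≤ cut M A + cut M B := by
  induction M using Multiset.induction_on with
  | empty => simp [cut_zero]
  | cons e M ih =>
    have : cr (A \ B) e + cr (B \ A) e ≤ cr A e + cr B e := by
      induction e using Sym2.ind with
      | _ u v =>
        simp only [cr_mk, Finset.mem_sdiff]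
        by_cases h1 : u ∈ A <;> by_cases h2 : u ∈ B <;> by_cases h3 : v ∈ A <;>
          by_cases h4 : v ∈ B <;> simp [h1, h2, h3, h4]
    simp only [cut_cons]; omega

theorem cut_posimod_edge (M : Multiset (Sym2 V)) (A B : Finset V) (x y : V)
    (he : s(x, y) ∈ M) (hxA : x ∉ A) (hxB : x ∉ B) (hyA : y ∈ A) (hyB : y ∈ B) :
    cut M (A \ B) + cut M (B \ A) + 2 ≤ cut M A + cut M B := by
  obtain ⟨M', rfl⟩ := Multiset.exists_cons_of_mem he
  have := cut_posimod M' A B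
  simp only [cut_cons, cr_mk, Finset.mem_sdiff, hxA, hxB, hyA, hyB]
  simp; omega

end Basics

/-! ### Instances -/

section Instances

variable [DecidableEq V]

/-- Distance to the nearest multiple of six. -/
def nm (t : ℤ) : ℤ := min (t % 6) (6 - t % 6)

/-- Degree of a vertex set, where `p`, `q` count arcs from and to the special vertex. -/
def dg (M : Multiset (Sym2 V)) (p q : V → ℤ) (A : Finset V) : ℤ :=
  cut M A + ∑ v ∈ A, (p v + q v)

/-- The induction hypotheses on a graph with a preoriented special vertex. -/
structure Inst (S : Finset V) (M : Multiset (Sym2 V)) (p q b : V → ℤ) : Prop where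
  edges : ∀ e ∈ M, ∀ v ∈ e, v ∈ S
  p0 : ∀ v ∈ S, 0 ≤ p v
  q0 : ∀ v ∈ S, 0 ≤ q v
  sum3 : 3 ∣ ∑ v ∈ S, b v + ∑ v ∈ S, p v - ∑ v ∈ S, q v
  par : ∀ A ⊆ S, (dg M p q A - ∑ v ∈ A, b v) % 2 = 0
  ii : ∑ v ∈ S, (p v + q v) ≤ 4 + nm (∑ v ∈ S, b v)
  iii : ∀ A ⊆ S, A.Nonempty → A ≠ S → 4 + nm (∑ v ∈ A, b v) ≤ dg M p q A

/-- The wanted orientation exists. -/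
def Sol (S : Finset V) (M : Multiset (Sym2 V)) (p q b : V → ℤ) : Prop :=
  ∃ c, Orn M c ∧ ∀ v ∈ S, 3 ∣ c v - b v - p v + q v

/-- Push-forward of a function. -/
def push (S : Finset V) (φ : V → V) (f : V → ℤ) (w : V) : ℤ :=
  ∑ v ∈ S.filter (fun v => φ v = w), f v

theorem sum_push (S : Finset V) (φ : V → V) (f : V → ℤ) (B : Finset V) :
    ∑ w ∈ B, push S φ f w = ∑ v ∈ S.filter (fun v => φ v ∈ B), f v := by
  unfold push
  exact Finset.sum_fiberwise_eq_sum_filter S B φ f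

theorem contract [Fintype V] {S : Finset V} {M : Multiset (Sym2 V)} {p q b : V → ℤ}
    (h : Inst S M p q b) (φ : V → V) :
    Inst (S.image φ) (M.map (Sym2.map φ)) (push S φ p) (push S φ q) (push S φ b) := by
  have himg : S.filter (fun v => φ v ∈ S.image φ) = S := by
    apply Finset.filter_true_of_mem
    intro v hv; exact Finset.mem_image_of_mem _ hv
  have hdg : ∀ B, dg (M.map (Sym2.map φ)) (push S φ p) (push S φ q) B
      = dg M p q (S.filter (fun v => φ v ∈ B)) := by
    intro B
    unfold dg
    rw [cut_map, cut_inter M S _ (S.filter (fun v => φ v ∈ B)) h.edges]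
    · rw [Finset.sum_add_distrib, sum_push, sum_push, Finset.sum_add_distrib]
    · intro v hv; simp [hv]
  refine ⟨?_, ?_, ?_, ?_, ?_, ?_, ?_⟩
  · intro e he v hv
    obtain ⟨e', he', rfl⟩ := Multiset.mem_map.1 he
    obtain ⟨u, hu, rfl⟩ := Sym2.mem_map.1 hv
    exact Finset.mem_image_of_mem _ (h.edges e' he' u hu)
  · intro v _
    exact Finset.sum_nonneg (fun u hu => h.p0 u (Finset.mem_filter.1 hu).1)
  · intro v _
    exact Finset.sum_nonneg (fun u hu => h.q0 u (Finset.mem_filter.1 hu).1)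
  · rw [sum_push, sum_push, sum_push, himg]; exact h.sum3
  · intro A _
    rw [hdg, sum_push]
    exact h.par _ (Finset.filter_subset _ _)
  · rw [Finset.sum_add_distrib, sum_push, sum_push, sum_push, himg, ← Finset.sum_add_distrib]
    exact h.ii
  · intro A hA hne hns
    rw [hdg, sum_push]
    apply h.iii _ (Finset.filter_subset _ _)
    · obtain ⟨w, hw⟩ := hne
      obtain ⟨v, hv, rfl⟩ := Finset.mem_image.1 (hA hw)
      exact ⟨v, by simp [hv, hw]⟩
    · intro heq
      apply hns
      apply Finset.Subset.antisymm hA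
      intro w hw
      obtain ⟨v, hv, rfl⟩ := Finset.mem_image.1 hw
      rw [← heq] at hv
      exact (Finset.mem_filter.1 hv).2

theorem Orn_supp_S {S : Finset V} {M : Multiset (Sym2 V)} {c : V → ℤ}
    (hS : ∀ e ∈ M, ∀ v ∈ e, v ∈ S) (h : Orn M c) {v : V} (hv : v ∉ S) : c v = 0 :=
  Orn_supp h (fun e he hve => hv (hS e he v hve))

theorem contract_sol [Fintype V] {S : Finset V} {M : Multiset (Sym2 V)} {p q b : V → ℤ}
    (h : Inst S M p q b) (φ : V → V)
    (hs : Sol (S.image φ) (M.map (Sym2.map φ)) (push S φ p) (push S φ q) (push S φ b)) :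
    ∃ c, Orn M c ∧ ∀ w ∈ S.image φ,
      3 ∣ ∑ v ∈ S.filter (fun v => φ v = w), (c v - b v - p v + q v) := by
  obtain ⟨c', hc', hw'⟩ := hs
  obtain ⟨c, hc, hcw⟩ := Orn_map φ hc'
  refine ⟨c, hc, fun w hw => ?_⟩
  have h1 := hw' w hw
  have h2 : c' w = ∑ v ∈ S.filter (fun v => φ v = w), c v := by
    rw [hcw]
    symm
    apply Finset.sum_subset
    · intro v hv; simp at hv; simp [hv]
    · intro v hv hv'
      apply Orn_supp_S h.edges hc
      intro hvS; apply hv'; simp at hv; simp [hv, hvS]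
  rw [h2] at h1
  simpa [push, Finset.sum_add_distrib, Finset.sum_sub_distrib] using h1

theorem parallel_step [Fintype V] {S : Finset V} {M : Multiset (Sym2 V)} {p q b : V → ℤ}
    (IH : ∀ (S' : Finset V) (M' : Multiset (Sym2 V)) (p' q' b' : V → ℤ), S'.card < S.card →
      Inst S' M' p' q' b' → Sol S' M' p' q' b')
    (h : Inst S M p q b) {x y : V} (hx : x ∈ S) (hy : y ∈ S) (hxy : y ≠ x)
    (hc : 2 ≤ M.count s(x, y)) : Sol S M p q b := by
  let φ : V → V := fun v => if v = y then x else v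
  have hφ : ∀ v, φ v = if v = y then x else v := fun v => rfl
  have hcard : (S.image φ).card < S.card := by
    refine lt_of_le_of_ne Finset.card_image_le (fun hh => ?_)
    have hinj := Finset.card_image_iff.1 hh
    exact hxy (hinj hy hx (by simp [hφ]))
  obtain ⟨c, hO, hcw⟩ := contract_sol h φ (IH _ _ _ _ _ hcard (contract h φ))
  obtain ⟨M0, rfl⟩ : ∃ M0, M = s(x, y) ::ₘ s(x, y) ::ₘ M0 := by
    have := Multiset.le_count_iff_replicate_le.1 hc
    obtain ⟨M0, rfl⟩ := Multiset.le_iff_exists_add.1 this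
    exact ⟨M0, by simp [Multiset.replicate_succ]⟩
  have hxx : 3 ∣ (c x - b x - p x + q x) + (c y - b y - p y + q y) := by
    have := hcw x (Finset.mem_image.2 ⟨x, hx, by simp [hφ, Ne.symm hxy]⟩)
    have hf : S.filter (fun v => φ v = x) = {x, y} := by
      ext v
      simp only [Finset.mem_filter, hφ, Finset.mem_insert, Finset.mem_singleton]
      constructor
      · rintro ⟨_, h⟩; split_ifs at h <;> simp_all
      · rintro (rfl | rfl)
        · simp [hx, Ne.symm hxy]
        · simp [hy]
    rw [hf, Finset.sum_pair (Ne.symm hxy)] at this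
    exact this
  have hvv : ∀ v ∈ S, v ≠ x → v ≠ y → 3 ∣ (c v - b v - p v + q v) := by
    intro v hv hvx hvy
    have := hcw v (Finset.mem_image.2 ⟨v, hv, by simp [hφ, hvy]⟩)
    have hf : S.filter (fun u => φ u = v) = {v} := by
      ext u
      simp only [Finset.mem_filter, hφ, Finset.mem_singleton]
      constructor
      · rintro ⟨_, h⟩; split_ifs at h <;> simp_all
      · rintro rfl; simp [hv, hvy]
    rw [hf, Finset.sum_singleton] at this
    exact this
  obtain ⟨c1, h1, hc1⟩ := (Orn_cons_iff x y).1 hO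
  obtain ⟨c0, h0, hc0⟩ := (Orn_cons_iff x y).1 h1
  -- it is enough to hit the right residue at `x`
  have main : ∀ k : ℤ, (k = 2 ∨ k = 0 ∨ k = -2) →
      Orn (s(x, y) ::ₘ s(x, y) ::ₘ M0) (fun v => c0 v + k * dl x v - k * dl y v) := by
    intro k hk
    rcases hk with rfl | rfl | rfl
    · convert Orn_cons x y (Orn_cons x y h0) using 1; ext v; simp; ring
    · convert Orn_cons' x y (Orn_cons x y h0) using 1; ext v; simp
    · convert Orn_cons' x y (Orn_cons' x y h0) using 1; ext v; simp; ring
  have hcc : ∃ j : ℤ, ∀ v, c v = c0 v + j * dl x v - j * dl y v := by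
    rcases hc0 with rfl | rfl <;> rcases hc1 with rfl | rfl
    · exact ⟨2, fun v => by simp; ring⟩
    · exact ⟨0, fun v => by simp⟩
    · exact ⟨0, fun v => by simp⟩
    · exact ⟨-2, fun v => by simp; ring⟩
  obtain ⟨j, hj⟩ := hcc
  have hjx := hj x
  have hjy := hj y
  simp only [dl_apply, if_true, hxy, Ne.symm hxy, if_false] at hjx hjy
  obtain ⟨k, hk, hkx⟩ : ∃ k : ℤ, (k = 2 ∨ k = 0 ∨ k = -2) ∧ 3 ∣ (c0 x + k - b x - p x + q x) := by
    have : (c0 x - b x - p x + q x) % 3 = 0 ∨ (c0 x - b x - p x + q x) % 3 = 1 ∨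
      (c0 x - b x - p x + q x) % 3 = 2 := by omega
    rcases this with h | h | h
    · exact ⟨0, by simp, by omega⟩
    · exact ⟨2, by simp, by omega⟩
    · exact ⟨-2, by simp, by omega⟩
  refine ⟨_, main k hk, ?_⟩
  intro v hv
  by_cases hvx : v = x
  · subst hvx
    simp only [dl_apply, if_true, Ne.symm hxy, if_false]; omega
  · by_cases hvy : v = y
    · subst hvy
      simp only [dl_apply, if_true, hxy, if_false]; omega
    · have := hvv v hv hvx hvy
      have h3 := hj v
      simp only [dl_apply, hvx, hvy, if_false] at h3 ⊢
      omega

/-- Turning oriented crossing edges into arcs at the special vertex. -/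
theorem cross_arcs (A : Finset V) (M : Multiset (Sym2 V)) : ∀ {c : V → ℤ}, Orn M c →
    (∀ e ∈ M, cr A e = 1) → ∃ p q : V → ℤ, (∀ v, 0 ≤ p v) ∧ (∀ v, 0 ≤ q v) ∧
      (∀ A' ⊆ A, ∑ v ∈ A', (p v + q v) = cut M A') ∧ (∀ v ∈ A, c v = q v - p v) := by
  induction M using Multiset.induction_on with
  | empty =>
    intro c h _
    rw [Orn_zero_iff] at h
    exact ⟨0, 0, by simp, by simp, by simp [cut_zero], by simp [h]⟩
  | cons e M ih =>
    have key : ∀ u v : V, u ∈ A → v ∉ A → ∀ {c : V → ℤ}, Orn (s(u, v) ::ₘ M) c →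
        (∀ e ∈ M, cr A e = 1) → ∃ p q : V → ℤ, (∀ v, 0 ≤ p v) ∧ (∀ v, 0 ≤ q v) ∧
        (∀ A' ⊆ A, ∑ v ∈ A', (p v + q v) = cut (s(u, v) ::ₘ M) A') ∧
        (∀ v ∈ A, c v = q v - p v) := by
      intro u v hu hv c h hM
      obtain ⟨c0, h0, hc⟩ := (Orn_cons_iff u v).1 h
      obtain ⟨p, q, hp, hq, hpq, hcc⟩ := ih h0 hM
      have hdl : ∀ u v : V, 0 ≤ dl u v := by intro u v; rw [dl_apply]; split_ifs <;> simp
      have hs : ∀ A' ⊆ A, ∑ w ∈ A', dl u w = cr A' s(u, v) := by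
        intro A' hA'
        have : v ∉ A' := fun h => hv (hA' h)
        simp only [dl_apply, cr_mk, this, iff_false, ite_not]
        simp
      have hz : ∀ w ∈ A, dl v w = 0 := by
        intro w hw
        rw [dl_apply, if_neg]; rintro rfl; exact hv hw
      rcases hc with rfl | rfl
      · refine ⟨p, q + dl u, hp, fun w => add_nonneg (hq w) (hdl u w), ?_, ?_⟩
        · intro A' hA'
          rw [cut_cons, ← hpq A' hA', ← hs A' hA', ← Finset.sum_add_distrib]
          apply Finset.sum_congr rfl; intro w _; simp; ring
        · intro w hw; simp [hcc w hw, hz w hw]; ring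
      · refine ⟨p + dl u, q, fun w => add_nonneg (hp w) (hdl u w), hq, ?_, ?_⟩
        · intro A' hA'
          rw [cut_cons, ← hpq A' hA', ← hs A' hA', ← Finset.sum_add_distrib]
          apply Finset.sum_congr rfl; intro w _; simp; ring
        · intro w hw; simp [hcc w hw, hz w hw]; ring
    induction e using Sym2.ind with
    | _ u v =>
      intro c h hM
      have hM' : ∀ e ∈ M, cr A e = 1 := fun e he => hM e (by simp [he])
      have huv := hM s(u, v) (by simp)
      rw [cr_mk] at huv
      by_cases hu : u ∈ A
      · have hv : v ∉ A := by intro hv; simp [hu, hv] at huv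
        exact key u v hu hv h hM'
      · have hv : v ∈ A := by by_contra hv; simp [hu, hv] at huv
        rw [Sym2.eq_swap] at h ⊢
        exact key v u hv hu h hM'

theorem sum_Orn {M : Multiset (Sym2 V)} {A : Finset V} : ∀ {c : V → ℤ}, Orn M c →
    (∀ e ∈ M, ∀ v ∈ e, v ∈ A) → ∑ v ∈ A, c v = 0 := by
  induction M using Multiset.induction_on with
  | empty => intro c h _; rw [Orn_zero_iff] at h; simp [h]
  | cons e M ih =>
    induction e using Sym2.ind with
    | _ a b =>
      intro c h hv
      rw [Orn_cons_iff] at h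
      obtain ⟨c0, h0, hc⟩ := h
      have h1 := ih h0 (fun e he => hv e (by simp [he]))
      have ha := hv s(a, b) (by simp) a (by simp)
      have hb := hv s(a, b) (by simp) b (by simp)
      rcases hc with rfl | rfl <;>
        simp [Finset.sum_sub_distrib, Finset.sum_add_distrib, dl_apply, h1, ha, hb]

theorem split_edges (M : Multiset (Sym2 V)) (A : Finset V) :
    ∃ MA MX MR : Multiset (Sym2 V), M = MA + MX + MR ∧ (∀ e ∈ MA, ∀ v ∈ e, v ∈ A) ∧
      (∀ e ∈ MX, cr A e = 1) ∧ (∀ e ∈ MR, ∀ v ∈ e, v ∉ A) := by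
  induction M using Multiset.induction_on with
  | empty => exact ⟨0, 0, 0, by simp⟩
  | cons e M ih =>
    obtain ⟨MA, MX, MR, rfl, h1, h2, h3⟩ := ih
    induction e using Sym2.ind with
    | _ u v =>
      by_cases hu : u ∈ A <;> by_cases hv : v ∈ A
      · refine ⟨s(u, v) ::ₘ MA, MX, MR, by simp, ?_, h2, h3⟩
        intro e he
        rcases Multiset.mem_cons.1 he with rfl | he
        · simp [hu, hv]
        · exact h1 e he
      · refine ⟨MA, s(u, v) ::ₘ MX, MR, by simp, h1, ?_, h3⟩
        intro e he
        rcases Multiset.mem_cons.1 he with rfl | he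
        · simp [cr_mk, hu, hv]
        · exact h2 e he
      · refine ⟨MA, s(u, v) ::ₘ MX, MR, by simp, h1, ?_, h3⟩
        intro e he
        rcases Multiset.mem_cons.1 he with rfl | he
        · simp [cr_mk, hu, hv]
        · exact h2 e he
      · refine ⟨MA, MX, s(u, v) ::ₘ MR, by simp, h1, h2, ?_⟩
        intro e he
        rcases Multiset.mem_cons.1 he with rfl | he
        · simp [hu, hv]
        · exact h3 e he

theorem tight_step [Fintype V] {S : Finset V} {M : Multiset (Sym2 V)} {p q b : V → ℤ}
    (IH : ∀ (S' : Finset V) (M' : Multiset (Sym2 V)) (p' q' b' : V → ℤ), S'.card < S.card →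
      Inst S' M' p' q' b' → Sol S' M' p' q' b')
    (h : Inst S M p q b) {A : Finset V} (hA : A ⊆ S) (hA2 : 2 ≤ A.card) (hAS : A ≠ S)
    (ht : dg M p q A < 6 + nm (∑ v ∈ A, b v)) : Sol S M p q b := by
  obtain ⟨a, ha, a', ha', haa⟩ := Finset.one_lt_card.1 hA2
  let φ : V → V := fun v => if v ∈ A then a else v
  have hφ : ∀ v, φ v = if v ∈ A then a else v := fun v => rfl
  have hcard : (S.image φ).card < S.card := by
    refine lt_of_le_of_ne Finset.card_image_le (fun hh => ?_)
    have hinj := Finset.card_image_iff.1 hh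
    exact haa (hinj (hA ha) (hA ha') (by simp [hφ, ha, ha']))
  obtain ⟨c, hO, hcw⟩ := contract_sol h φ (IH _ _ _ _ _ hcard (contract h φ))
  have hAA : 3 ∣ ∑ v ∈ A, (c v - b v - p v + q v) := by
    have := hcw a (Finset.mem_image.2 ⟨a, hA ha, by simp [hφ]⟩)
    have hf : S.filter (fun v => φ v = a) = A := by
      ext v
      simp only [Finset.mem_filter, hφ]
      constructor
      · rintro ⟨_, h⟩
        by_contra hv
        rw [if_neg hv] at h
        exact hv (h ▸ ha)
      · intro hv; simp [hv, hA hv]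
    rwa [hf] at this
  have hvv : ∀ v ∈ S, v ∉ A → 3 ∣ (c v - b v - p v + q v) := by
    intro v hv hvA
    have := hcw v (Finset.mem_image.2 ⟨v, hv, by simp [hφ, hvA]⟩)
    have hf : S.filter (fun u => φ u = v) = {v} := by
      ext u
      simp only [Finset.mem_filter, hφ, Finset.mem_singleton]
      constructor
      · rintro ⟨_, h⟩
        split_ifs at h
        · exact absurd (h ▸ ha) hvA
        · exact h
      · rintro rfl; simp [hv, hvA]
    rw [hf, Finset.sum_singleton] at this
    exact this
  obtain ⟨MA, MX, MR, rfl, hMA, hMX, hMR⟩ := split_edges M A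
  obtain ⟨c12, cR, rfl, hO12, hOR⟩ := Orn_split hO
  obtain ⟨cA, cX, rfl, hOA, hOX⟩ := Orn_split hO12
  obtain ⟨pX, qX, hpX, hqX, hpq, hcX⟩ := cross_arcs A MX hOX hMX
  have hcR0 : ∀ v ∈ A, cR v = 0 := fun v hv => Orn_supp hOR (fun e he hve => hMR e he v hve hv)
  have hcA0 : ∀ v, v ∉ A → cA v = 0 := fun v hv => Orn_supp hOA (fun e he hve => hv (hMA e he v hve))
  have hcutR : ∀ A' ⊆ A, cut MR A' = 0 := by
    intro A' hA'
    apply cut_eq_zero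
    intro e he
    have := hMR e he
    induction e using Sym2.ind with
    | _ u v =>
      have hu : u ∉ A' := fun hh => this u (by simp) (hA' hh)
      have hv : v ∉ A' := fun hh => this v (by simp) (hA' hh)
      simp [cr_mk, hu, hv]
  have hdg : ∀ A' ⊆ A, dg MA (p + pX) (q + qX) A' = dg (MA + MX + MR) p q A' := by
    intro A' hA'
    unfold dg
    rw [cut_add, cut_add, hcutR A' hA', ← hpq A' hA', add_zero, add_assoc, ← Finset.sum_add_distrib]
    congr 1
    apply Finset.sum_congr rfl
    intro v _; simp; ring
  have hcutA : cut MA A = 0 := by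
    apply cut_eq_zero
    intro e he
    have := hMA e he
    induction e using Sym2.ind with
    | _ u v =>
      have hu := this u (by simp)
      have hv := this v (by simp)
      simp [cr_mk, hu, hv]
  have hpar := h.par A hA
  have hiii := h.iii A hA ⟨a, ha⟩ hAS
  have hwA : ∑ v ∈ A, ((p + pX) v + (q + qX) v) = dg (MA + MX + MR) p q A := by
    rw [← hdg A (Finset.Subset.refl A), dg, hcutA, zero_add]
  have hsumX : ∑ v ∈ A, cX v = ∑ v ∈ A, qX v - ∑ v ∈ A, pX v := by
    rw [← Finset.sum_sub_distrib]; exact Finset.sum_congr rfl hcX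
  have hsumA := sum_Orn hOA hMA
  have hsumR : ∑ v ∈ A, cR v = 0 := Finset.sum_eq_zero hcR0
  have hinst : Inst A MA (p + pX) (q + qX) b := by
    refine ⟨hMA, ?_, ?_, ?_, ?_, ?_, ?_⟩
    · intro v hv; exact add_nonneg (h.p0 v (hA hv)) (hpX v)
    · intro v hv; exact add_nonneg (h.q0 v (hA hv)) (hqX v)
    · simp only [Finset.sum_add_distrib, Finset.sum_sub_distrib, Pi.add_apply] at hAA ⊢
      omega
    · intro A' hA'
      rw [hdg A' hA']; exact h.par A' (hA'.trans hA)
    · rw [hwA]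
      generalize dg (MA + MX + MR) p q A = d at *
      generalize ∑ v ∈ A, b v = β at *
      unfold nm at *
      omega
    · intro A' hA' hne hns
      rw [hdg A' hA']
      apply h.iii A' (hA'.trans hA) hne
      rintro rfl
      exact hAS (Finset.Subset.antisymm hA hA')
  have hlt : A.card < S.card := Finset.card_lt_card (Finset.ssubset_iff_subset_ne.2 ⟨hA, hAS⟩)
  obtain ⟨c2, hO2, hc2⟩ := IH _ _ _ _ _ hlt hinst
  refine ⟨c2 + cX + cR, Orn_add (Orn_add hO2 hOX) hOR, ?_⟩
  intro v hv
  by_cases hvA : v ∈ A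
  · have h1 := hc2 v hvA
    have h2 := hcX v hvA
    have h3 := hcR0 v hvA
    simp only [Pi.add_apply] at h1 ⊢
    omega
  · have h1 := hvv v hv hvA
    have h2 := hcA0 v hvA
    have h3 : c2 v = 0 := Orn_supp hO2 (fun e he hve => hvA (hMA e he v hve))
    simp only [Pi.add_apply] at h1 ⊢
    omega

end Instances

/-! ### Reductions -/

section Reductions

variable [DecidableEq V]

theorem sum_dl (A : Finset V) (x : V) : ∑ v ∈ A, dl x v = if x ∈ A then 1 else 0 := by
  simp [dl_apply]

theorem Orn_neg {M : Multiset (Sym2 V)} : ∀ {c : V → ℤ}, Orn M c → Orn M (-c) := by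
  induction M using Multiset.induction_on with
  | empty => intro c h; rw [Orn_zero_iff] at h ⊢; simp [h]
  | cons e M ih =>
    induction e using Sym2.ind with
    | _ u v =>
      intro c h
      obtain ⟨c0, h0, rfl | rfl⟩ := (Orn_cons_iff u v).1 h
      · convert Orn_cons' u v (ih h0) using 1; abel
      · convert Orn_cons u v (ih h0) using 1; abel

theorem nm_neg (t : ℤ) : nm (-t) = nm t := by unfold nm; omega

theorem dg_swap (M : Multiset (Sym2 V)) (p q : V → ℤ) (A : Finset V) :
    dg M q p A = dg M p q A := by
  unfold dg; congr 1; apply Finset.sum_congr rfl; intro v _; ring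

theorem Inst.neg {S : Finset V} {M : Multiset (Sym2 V)} {p q b : V → ℤ}
    (h : Inst S M p q b) : Inst S M q p (-b) := by
  refine ⟨h.edges, h.q0, h.p0, ?_, ?_, ?_, ?_⟩
  · have := h.sum3
    simp only [Pi.neg_apply, Finset.sum_neg_distrib]; omega
  · intro A hA
    have := h.par A hA
    rw [dg_swap]
    simp only [Pi.neg_apply, Finset.sum_neg_distrib]; omega
  · have := h.ii
    simp only [Pi.neg_apply, Finset.sum_neg_distrib, nm_neg, Finset.sum_add_distrib] at this ⊢
    omega
  · intro A hA hne hns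
    have := h.iii A hA hne hns
    rw [dg_swap]
    simp only [Pi.neg_apply, Finset.sum_neg_distrib, nm_neg]; exact this

theorem Sol.neg {S : Finset V} {M : Multiset (Sym2 V)} {p q b : V → ℤ}
    (h : Sol S M q p (-b)) : Sol S M p q b := by
  obtain ⟨c, hO, hc⟩ := h
  refine ⟨-c, Orn_neg hO, fun v hv => ?_⟩
  have := hc v hv
  simp only [Pi.neg_apply] at this ⊢
  omega

/-- Every large cut has room. -/
def Roomy (S : Finset V) (M : Multiset (Sym2 V)) (p q b : V → ℤ) : Prop :=
  ∀ A ⊆ S, 2 ≤ A.card → A ≠ S → 6 + nm (∑ v ∈ A, b v) ≤ dg M p q A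

/-- Induction hypothesis with the same vertex set. -/
def IHsame (S : Finset V) (M : Multiset (Sym2 V)) (p q : V → ℤ) : Prop :=
  ∀ (M' : Multiset (Sym2 V)) (p₁ q₁ β : V → ℤ),
    (M'.card : ℤ) + ∑ v ∈ S, (p₁ v + q₁ v) < (M.card : ℤ) + ∑ v ∈ S, (p v + q v) →
      Inst S M' p₁ q₁ β → Sol S M' p₁ q₁ β

/-- Induction hypothesis with fewer vertices. -/
def IHless (S : Finset V) : Prop :=
  ∀ (S' : Finset V) (M' : Multiset (Sym2 V)) (p₁ q₁ β : V → ℤ), S'.card < S.card →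
      Inst S' M' p₁ q₁ β → Sol S' M' p₁ q₁ β

theorem card_cases {A : Finset V} (h : A.Nonempty) : (∃ v, A = {v}) ∨ 2 ≤ A.card := by
  have : 0 < A.card := Finset.card_pos.2 h
  by_cases h1 : A.card = 1
  · left; exact Finset.card_eq_one.1 h1
  · right; omega

theorem arc_step {S : Finset V} {M : Multiset (Sym2 V)} {p q b : V → ℤ}
    (IH : IHsame S M p q) (h : Inst S M p q b) (hr : Roomy S M p q b)
    {x : V} (hx : x ∈ S) (hp : 1 ≤ p x) (hd : 4 + nm (b x + 1) ≤ dg M p q {x} - 1) :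
    Sol S M p q b := by
  have hi : Inst S M (p - dl x) q (b + dl x) := by
    have hdg : ∀ A, dg M (p - dl x) q A = dg M p q A - (if x ∈ A then 1 else 0) := by
      intro A
      rw [← sum_dl]
      simp only [dg, Pi.sub_apply, Finset.sum_add_distrib, Finset.sum_sub_distrib]; ring
    have hb : ∀ A : Finset V, ∑ v ∈ A, (b + dl x) v = ∑ v ∈ A, b v + (if x ∈ A then 1 else 0) := by
      intro A
      rw [← sum_dl]
      simp only [Pi.add_apply, Finset.sum_add_distrib]
    refine ⟨h.edges, ?_, h.q0, ?_, ?_, ?_, ?_⟩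
    · intro v hv
      have := h.p0 v hv
      simp only [Pi.sub_apply, dl_apply]
      split_ifs with hvx
      · subst hvx; omega
      · omega
    · have := h.sum3
      rw [hb]
      simp only [Pi.sub_apply, Finset.sum_sub_distrib, sum_dl, hx, if_true]
      omega
    · intro A hA
      have := h.par A hA
      rw [hb, hdg]; split_ifs <;> omega
    · have := h.ii
      rw [hb]
      simp only [Pi.sub_apply, Finset.sum_sub_distrib, Finset.sum_add_distrib, sum_dl, hx, if_true] at this ⊢
      unfold nm at *
      omega
    · intro A hA hne hns
      rw [hb, hdg]
      have h3 := h.iii A hA hne hns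
      by_cases hxA : x ∈ A
      · simp only [hxA, if_true]
        rcases card_cases hne with ⟨v, rfl⟩ | h2
        · have : x = v := by simpa using hxA
          subst this
          simpa using hd
        · have := hr A hA h2 hns
          unfold nm at *
          omega
      · simp only [hxA, if_false]; simpa using h3
  have hlt : (M.card : ℤ) + ∑ v ∈ S, ((p - dl x) v + q v) < (M.card : ℤ) + ∑ v ∈ S, (p v + q v) := by
    simp only [Pi.sub_apply, Finset.sum_sub_distrib, Finset.sum_add_distrib, sum_dl, hx, if_true]
    omega
  obtain ⟨c, hO, hc⟩ := IH _ _ _ _ hlt hi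
  refine ⟨c, hO, fun v hv => ?_⟩
  have := hc v hv
  simp only [Pi.sub_apply, Pi.add_apply] at this
  have e : c v - b v - p v + q v = c v - (b v + dl x v) - (p v - dl x v) + q v := by ring
  rw [e]; exact this

theorem lift_step {S : Finset V} {M M0 : Multiset (Sym2 V)} {p q b : V → ℤ}
    (IH : IHsame S M p q) (h : Inst S M p q b) (hr : Roomy S M p q b)
    {x y w : V} (hxy : y ≠ x) (hxw : w ≠ x) (hyw : y ≠ w)
    (hM : M = s(x, y) ::ₘ s(x, w) ::ₘ M0)
    (hd : 6 + nm (b x) ≤ dg M p q {x}) : Sol S M p q b := by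
  subst hM
  have hcrpar : ∀ A, (cr A s(x, y) + cr A s(x, w) - cr A s(y, w)) % 2 = 0 ∧
      cr A s(x, y) + cr A s(x, w) - cr A s(y, w) ≤ 2 := by
    intro A
    simp only [cr_mk]
    by_cases h1 : x ∈ A <;> by_cases h2 : y ∈ A <;> by_cases h3 : w ∈ A <;> simp [h1, h2, h3]
  have hcr1 : ∀ v, v ≠ x → cr {v} s(x, y) + cr {v} s(x, w) - cr {v} s(y, w) = 0 := by
    intro v hv
    simp only [cr_mk, Finset.mem_singleton]
    by_cases h2 : y = v <;> by_cases h3 : w = v <;> simp [h2, h3, hv.symm]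
    exact hyw (h2.trans h3.symm)
  have hdg : ∀ A, dg (s(y, w) ::ₘ M0) p q A = dg (s(x, y) ::ₘ s(x, w) ::ₘ M0) p q A -
      (cr A s(x, y) + cr A s(x, w) - cr A s(y, w)) := by
    intro A; simp only [dg, cut_cons]; ring
  have hi : Inst S (s(y, w) ::ₘ M0) p q b := by
    have hy : y ∈ S := h.edges s(x, y) (by simp) y (by simp)
    have hw : w ∈ S := h.edges s(x, w) (by simp) w (by simp)
    refine ⟨?_, h.p0, h.q0, h.sum3, ?_, h.ii, ?_⟩
    · intro e he
      rcases Multiset.mem_cons.1 he with rfl | he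
      · simp [hy, hw]
      · exact h.edges e (by simp [he])
    · intro A hA
      have h1 := h.par A hA
      have h2 := hcrpar A
      rw [hdg]; omega
    · intro A hA hne hns
      rw [hdg]
      have h2 := hcrpar A
      have h3 := h.iii A hA hne hns
      rcases card_cases hne with ⟨v, rfl⟩ | h4
      · by_cases hv : v = x
        · subst hv
          simp only [Finset.sum_singleton]; omega
        · rw [hcr1 v hv]; omega
      · have := hr A hA h4 hns
        omega
  have hlt : ((s(y, w) ::ₘ M0).card : ℤ) + ∑ v ∈ S, (p v + q v) <
      ((s(x, y) ::ₘ s(x, w) ::ₘ M0).card : ℤ) + ∑ v ∈ S, (p v + q v) := by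
    simp
  obtain ⟨c, hO, hc⟩ := IH _ _ _ _ hlt hi
  exact ⟨c, Orn_lift x y w hO, hc⟩

theorem delete_step {S : Finset V} {M : Multiset (Sym2 V)} {p q b : V → ℤ}
    (IH : IHsame S M p q) (h : Inst S M p q b) (hr : Roomy S M p q b)
    {x y : V} (hxy : y ≠ x) (hM : s(x, y) ∈ M)
    (hx : 1 ≤ b x % 6 ∧ b x % 6 ≤ 3) (hy : 3 ≤ b y % 6) : Sol S M p q b := by
  obtain ⟨M0, rfl⟩ := Multiset.exists_cons_of_mem hM
  have hxS : x ∈ S := h.edges s(x, y) (by simp) x (by simp)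
  have hyS : y ∈ S := h.edges s(x, y) (by simp) y (by simp)
  have hdg : ∀ A, dg M0 p q A = dg (s(x, y) ::ₘ M0) p q A - cr A s(x, y) := by
    intro A; simp only [dg, cut_cons]; ring
  have hb : ∀ A : Finset V, ∑ v ∈ A, (b - dl x + dl y) v = ∑ v ∈ A, b v
      - (if x ∈ A then 1 else 0) + (if y ∈ A then 1 else 0) := by
    intro A
    rw [← sum_dl, ← sum_dl]
    simp only [Pi.add_apply, Pi.sub_apply, Finset.sum_add_distrib, Finset.sum_sub_distrib]
  have hbS : ∑ v ∈ S, (b - dl x + dl y) v = ∑ v ∈ S, b v := by rw [hb]; simp [hxS, hyS]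
  have hi : Inst S M0 p q (b - dl x + dl y) := by
    refine ⟨fun e he => h.edges e (by simp [he]), h.p0, h.q0, ?_, ?_, ?_, ?_⟩
    · rw [hbS]; exact h.sum3
    · intro A hA
      have := h.par A hA
      rw [hb, hdg, cr_mk]
      by_cases h1 : x ∈ A <;> by_cases h2 : y ∈ A <;> simp [h1, h2] <;> omega
    · rw [hbS]; exact h.ii
    · intro A hA hne hns
      have h3 := h.iii A hA hne hns
      rw [hb, hdg, cr_mk]
      rcases card_cases hne with ⟨v, rfl⟩ | h4
      · simp only [Finset.mem_singleton, Finset.sum_singleton] at h3 ⊢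
        by_cases h1 : x = v
        · subst h1
          simp only [hxy, if_true, if_false, iff_false, not_true] at h3 ⊢
          unfold nm at *; omega
        · by_cases h2 : y = v
          · subst h2
            simp only [h1, if_true, if_false, iff_true] at h3 ⊢
            unfold nm at *; omega
          · simp only [h1, h2, if_false, iff_self, if_true]; simpa using h3
      · have := hr A hA h4 hns
        by_cases h1 : x ∈ A <;> by_cases h2 : y ∈ A <;>
          simp only [h1, h2, if_true, if_false, iff_true, iff_false, not_true, not_false_iff] <;>
          unfold nm at * <;> omega
  have hlt : (M0.card : ℤ) + ∑ v ∈ S, (p v + q v) <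
      ((s(x, y) ::ₘ M0).card : ℤ) + ∑ v ∈ S, (p v + q v) := by
    simp
  obtain ⟨c, hO, hc⟩ := IH _ _ _ _ hlt hi
  refine ⟨_, Orn_cons x y hO, fun v hv => ?_⟩
  have := hc v hv
  simp only [Pi.sub_apply, Pi.add_apply] at this ⊢
  have e : c v + dl x v - dl y v - b v - p v + q v = c v - (b v - dl x v + dl y v) - p v + q v := by
    ring
  rw [e]; exact this

/-- No parallel edges. -/
def Simp (M : Multiset (Sym2 V)) : Prop := ∀ x y, y ≠ x → M.count s(x, y) ≤ 1

theorem star_pack {S : Finset V} {M : Multiset (Sym2 V)} (hS : ∀ e ∈ M, ∀ v ∈ e, v ∈ S)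
    (hs : Simp M) (x : V) :
    ∃ (Y : Finset V) (K R : Multiset (Sym2 V)), M = Y.val.map (fun y => s(x, y)) + K + R ∧
      Y ⊆ S.erase x ∧ (∀ e ∈ K, e = s(x, x)) ∧ (∀ e ∈ R, ∀ v ∈ e, v ∈ S.erase x) ∧
      (∀ A, x ∉ A → cut M A = ((Y ∩ A).card : ℤ) + cut R A) ∧
      (∀ A, x ∉ A → cut M (insert x A) = (Y.card : ℤ) - ((Y ∩ A).card : ℤ) + cut R A) := by
  obtain ⟨Y, K, R, rfl, hY, hK, hR⟩ := star_finset M x (hs x)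
  refine ⟨Y, K, R, rfl, ?_, hK, ?_, ?_, ?_⟩
  · intro y hy
    rw [Finset.mem_erase]
    refine ⟨fun hh => hY (hh ▸ hy), hS s(x, y) ?_ y (by simp)⟩
    simp only [Multiset.mem_add, Multiset.mem_map]
    left; left; exact ⟨y, hy, rfl⟩
  · intro e he v hv
    rw [Finset.mem_erase]
    refine ⟨fun hh => hR e he (hh ▸ hv), hS e ?_ v hv⟩
    simp [he]
  · intro A hA
    rw [cut_add, cut_add, cut_starY Y x A hA, cut_loops K x hK]; ring
  · intro A hA
    rw [cut_add, cut_add, cut_starY' Y x _ (by simp), cut_loops K x hK]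
    have h1 : Y ∩ insert x A = Y ∩ A := by
      ext v; simp only [Finset.mem_inter, Finset.mem_insert]
      constructor
      · rintro ⟨h1, rfl | h2⟩
        · exact absurd h1 hY
        · exact ⟨h1, h2⟩
      · rintro ⟨h1, h2⟩; exact ⟨h1, Or.inr h2⟩
    have h2 : cut R (insert x A) = cut R A := by
      apply cut_congr
      intro e he
      have := hR e he
      induction e using Sym2.ind with
      | _ u v =>
        simp only [Sym2.mem_iff, not_or] at this
        simp [cr_mk, Ne.symm this.1, Ne.symm this.2]
    rw [h1, h2]; ring

end Reductions

/-! ### Star contraction -/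

section StarContract

variable [DecidableEq V]

/-- The edges at `x` split off from the rest. -/
structure Pack (S : Finset V) (M : Multiset (Sym2 V)) (x : V) (Y : Finset V)
    (K R : Multiset (Sym2 V)) : Prop where
  hM : M = Y.val.map (fun y => s(x, y)) + K + R
  hY : Y ⊆ S.erase x
  hK : ∀ e ∈ K, e = s(x, x)
  hR : ∀ e ∈ R, ∀ v ∈ e, v ∈ S.erase x
  hA : ∀ A : Finset V, x ∉ A → cut M A = ((Y ∩ A).card : ℤ) + cut R A
  hI : ∀ A : Finset V, x ∉ A → cut M (insert x A) = (Y.card : ℤ) - ((Y ∩ A).card : ℤ) + cut R A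

/-- Indicator function. -/
def ind (O : Finset V) (v : V) : ℤ := if v ∈ O then 1 else 0

theorem sum_ind (O A : Finset V) : ∑ v ∈ A, ind O v = ((A ∩ O).card : ℤ) := by
  unfold ind
  rw [Finset.sum_ite_mem]; simp

theorem Orn_star (x : V) (O : Finset V) :
    Orn (O.val.map (fun y => s(x, y))) (fun v => (O.card : ℤ) * dl x v - ind O v) := by
  induction O using Finset.induction_on with
  | empty =>
    have : (fun v => ((∅ : Finset V).card : ℤ) * dl x v - ind ∅ v) = 0 := by
      funext v; simp [ind]
    rw [this]; exact Orn_zero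
  | insert a O ha ih =>
    rw [Finset.insert_val_of_notMem ha, Multiset.map_cons]
    convert Orn_cons x a ih using 1
    funext v
    simp only [Pi.add_apply, Pi.sub_apply, Finset.card_insert_of_notMem ha, ind, dl_apply,
      Finset.mem_insert]
    push_cast
    by_cases h1 : v = a
    · subst h1; simp only [ha, or_false, if_true, if_false]; ring
    · simp only [h1, false_or, if_false]; ring

theorem Pack.edge {S : Finset V} {M : Multiset (Sym2 V)} {x : V} {Y : Finset V}
    {K R : Multiset (Sym2 V)} (P : Pack S M x Y K R) {y : V} (hy : y ∈ Y) : s(x, y) ∈ M := by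
  rw [P.hM]
  simp only [Multiset.mem_add, Multiset.mem_map]
  exact Or.inl (Or.inl ⟨y, hy, rfl⟩)

theorem star_contract {S : Finset V} {M : Multiset (Sym2 V)} {p q b : V → ℤ}
    (IH : IHless S) (h : Inst S M p q b) {x : V} (hx : x ∈ S) {Y O I D : Finset V}
    {K R : Multiset (Sym2 V)} (P : Pack S M x Y K R) (hYe : Y = (O ∪ I) ∪ D)
    (hOI : Disjoint O I) (hD : Disjoint (O ∪ I) D)
    (h3 : 3 ∣ (O.card : ℤ) - I.card - D.card - b x - p x + q x)
    (h2 : ∑ v ∈ S, (p v + q v) - p x - q x + O.card + I.card ≤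
      4 + nm (∑ v ∈ S, b v - b x - D.card))
    (hiii : ∀ A ⊆ S.erase x, A.Nonempty → A ≠ S.erase x →
      4 + nm (∑ v ∈ A, b v - (A ∩ D).card) ≤ dg M p q A - (A ∩ D).card) :
    Sol S M p q b := by
  have hdg : ∀ A ⊆ S.erase x, dg R (p + ind O) (q + ind I) A = dg M p q A - (A ∩ D).card := by
    intro A hA
    have hxA : x ∉ A := fun hh => by simpa using hA hh
    simp only [dg, Pi.add_apply, Finset.sum_add_distrib, sum_ind, P.hA A hxA]
    have e : Y ∩ A = ((A ∩ O) ∪ (A ∩ I)) ∪ (A ∩ D) := by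
      rw [hYe]; ext v; simp; tauto
    have d1 : Disjoint (A ∩ O) (A ∩ I) := hOI.mono inter_subset_right inter_subset_right
    have d2 : Disjoint ((A ∩ O) ∪ (A ∩ I)) (A ∩ D) := by
      rw [← Finset.inter_union_distrib_left]
      exact hD.mono inter_subset_right inter_subset_right
    rw [e, Finset.card_union_of_disjoint d2, Finset.card_union_of_disjoint d1]
    push_cast; ring
  have hb : ∀ A : Finset V, ∑ v ∈ A, (b - ind D) v = ∑ v ∈ A, b v - (A ∩ D).card := by
    intro A; simp only [Pi.sub_apply, Finset.sum_sub_distrib, sum_ind]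
  have hO : O ⊆ S.erase x := fun v hv => P.hY (by rw [hYe]; simp [hv])
  have hI : I ⊆ S.erase x := fun v hv => P.hY (by rw [hYe]; simp [hv])
  have hDS : D ⊆ S.erase x := fun v hv => P.hY (by rw [hYe]; simp [hv])
  have hsb := Finset.add_sum_erase S b hx
  have hsp := Finset.add_sum_erase S p hx
  have hsq := Finset.add_sum_erase S q hx
  have hi : Inst (S.erase x) R (p + ind O) (q + ind I) (b - ind D) := by
    refine ⟨P.hR, ?_, ?_, ?_, ?_, ?_, ?_⟩
    · intro v hv
      have := h.p0 v (Finset.mem_of_mem_erase hv)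
      simp only [Pi.add_apply, ind]; split_ifs <;> omega
    · intro v hv
      have := h.q0 v (Finset.mem_of_mem_erase hv)
      simp only [Pi.add_apply, ind]; split_ifs <;> omega
    · have := h.sum3
      rw [hb]
      simp only [Pi.add_apply, Finset.sum_add_distrib, sum_ind,
        Finset.inter_eq_right.2 hO, Finset.inter_eq_right.2 hI, Finset.inter_eq_right.2 hDS]
      omega
    · intro A hA
      rw [hb, hdg A hA]
      have := h.par A (hA.trans (Finset.erase_subset _ _))
      omega
    · rw [hb]
      simp only [Pi.add_apply, Finset.sum_add_distrib, sum_ind,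
        Finset.inter_eq_right.2 hO, Finset.inter_eq_right.2 hI, Finset.inter_eq_right.2 hDS] at h2 ⊢
      have e : ∑ v ∈ S.erase x, b v - (D.card : ℤ) = ∑ v ∈ S, b v - b x - D.card := by
        rw [← hsb]; ring
      rw [e]; linarith
    · intro A hA hne hns
      rw [hb, hdg A hA]
      exact hiii A hA hne hns
  obtain ⟨c, hOr, hc⟩ := IH _ _ _ _ _ (Finset.card_erase_lt_of_mem hx) hi
  have o1 := Orn_star x O
  have o2 := Orn_neg (Orn_star x I)
  have o3 := Orn_neg (Orn_star x D)
  have hval : Y.val = O.val + I.val + D.val := by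
    rw [hYe, ← Finset.disjUnion_eq_union _ _ hD, Finset.disjUnion_val,
      ← Finset.disjUnion_eq_union _ _ hOI, Finset.disjUnion_val]
  have o4 := Orn_loops K (fun e he => ⟨x, P.hK e he⟩) (Orn_add (Orn_add (Orn_add o1 o2) o3) hOr)
  have o5 : M = K + (Multiset.map (fun y => s(x, y)) O.val + Multiset.map (fun y => s(x, y)) I.val +
      Multiset.map (fun y => s(x, y)) D.val + R) := by
    rw [P.hM, hval, Multiset.map_add, Multiset.map_add]
    abel
  rw [← o5] at o4
  refine ⟨_, o4, ?_⟩
  · intro v hv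
    by_cases hvx : v = x
    · subst hvx
      have c0 : c v = 0 := Orn_supp_S P.hR hOr (by simp)
      have n1 : v ∉ O := fun hh => by simpa using hO hh
      have n2 : v ∉ I := fun hh => by simpa using hI hh
      have n3 : v ∉ D := fun hh => by simpa using hDS hh
      simp only [Pi.add_apply, Pi.neg_apply, dl_apply, ind, c0, n1, n2, n3, if_true, if_false]
      convert h3 using 1
      ring
    · have := hc v (Finset.mem_erase.2 ⟨hvx, hv⟩)
      simp only [Pi.add_apply, Pi.sub_apply, Pi.neg_apply, dl_apply, hvx, if_false] at this ⊢
      convert this using 1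
      ring

end StarContract

/-! ### Vertices with zero boundary -/

section ZeroStep

variable [DecidableEq V]

theorem Pack.cutx {S : Finset V} {M : Multiset (Sym2 V)} {x : V} {Y : Finset V}
    {K R : Multiset (Sym2 V)} (P : Pack S M x Y K R) : cut M {x} = Y.card := by
  have := P.hI ∅ (by simp)
  have h0 : cut R ∅ = 0 := by
    apply cut_eq_zero
    intro e _
    induction e using Sym2.ind with
    | _ u v => simp [cr_mk]
  simpa [h0] using this

theorem dg_single (M : Multiset (Sym2 V)) (p q : V → ℤ) (x : V) :
    dg M p q {x} = cut M {x} + p x + q x := by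
  simp [dg, add_assoc]

theorem dg_erase {S : Finset V} {M : Multiset (Sym2 V)} {p q b : V → ℤ}
    (h : Inst S M p q b) {x : V} (hx : x ∈ S) :
    dg M p q (S.erase x) = cut M {x} + ∑ v ∈ S, (p v + q v) - p x - q x := by
  have := Finset.add_sum_erase S (fun v => p v + q v) hx
  have h2 : cut M (S.erase x) = cut M {x} := by
    rw [← cut_compl M S {x} h.edges, Finset.sdiff_singleton_eq_erase]
  unfold dg
  rw [h2]; linarith

theorem dg_insert {S : Finset V} {M : Multiset (Sym2 V)} {x : V} {Y : Finset V}
    {K R : Multiset (Sym2 V)} (P : Pack S M x Y K R) (p q : V → ℤ) {A : Finset V} (hxA : x ∉ A) :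
    dg M p q (insert x A) = dg M p q A + Y.card - 2 * (Y ∩ A).card + p x + q x := by
  unfold dg
  rw [P.hI A hxA, P.hA A hxA, Finset.sum_insert hxA]; ring

theorem insert_ne {S A : Finset V} {x : V} (hxA : x ∉ A) (hA : A ≠ S.erase x) : insert x A ≠ S := by
  intro hh
  apply hA
  rw [← hh, Finset.erase_insert hxA]

theorem zero_step0 {S : Finset V} {M : Multiset (Sym2 V)} {p q b : V → ℤ}
    (IH : IHless S) (h : Inst S M p q b) (hr : Roomy S M p q b) {x : V} (hx : x ∈ S)
    {Y : Finset V} {K R : Multiset (Sym2 V)} (P : Pack S M x Y K R)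
    (hb : b x % 6 = 0) (hp : p x = 0) (hq : q x = 0) (hY : Y.card = 4) : Sol S M p q b := by
  obtain ⟨y1, Y', hn, rfl, hc3⟩ := Finset.card_eq_succ.1 hY
  obtain ⟨y2, y3, y4, h23, h24, h34, rfl⟩ := Finset.card_eq_three.1 hc3
  simp only [Finset.mem_insert, Finset.mem_singleton, not_or] at hn
  obtain ⟨h12, h13, h14⟩ := hn
  have hYS := P.hY
  have m1 : y1 ∈ S.erase x := hYS (by simp)
  have m2 : y2 ∈ S.erase x := hYS (by simp)
  have m3 : y3 ∈ S.erase x := hYS (by simp)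
  have m4 : y4 ∈ S.erase x := hYS (by simp)
  have hcard : ∀ A : Finset V, ((({y1, y2, y3, y4} : Finset V) ∩ A).card : ℤ) =
      (if y1 ∈ A then 1 else 0) + (if y2 ∈ A then 1 else 0) + (if y3 ∈ A then 1 else 0) +
      (if y4 ∈ A then 1 else 0) := by
    intro A
    have := sum_ind A {y1, y2, y3, y4}
    rw [← this]
    rw [Finset.sum_insert (by simp [h12, h13, h14]), Finset.sum_insert (by simp [h23, h24]),
      Finset.sum_insert (by simp [h34]), Finset.sum_singleton]
    simp only [ind]; ring
  have hdg : ∀ A : Finset V, x ∉ A → dg (s(y1, y2) ::ₘ s(y3, y4) ::ₘ R) p q A = dg M p q A -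
      (if y1 ∈ A ∧ y2 ∈ A then 2 else 0) - (if y3 ∈ A ∧ y4 ∈ A then 2 else 0) := by
    intro A hA
    unfold dg
    rw [P.hA A hA, hcard, cut_cons, cut_cons, cr_mk, cr_mk]
    by_cases a1 : y1 ∈ A <;> by_cases a2 : y2 ∈ A <;> by_cases a3 : y3 ∈ A <;>
      by_cases a4 : y4 ∈ A <;> simp [a1, a2, a3, a4] <;> ring
  have hsb := Finset.add_sum_erase S b hx
  have hsp := Finset.add_sum_erase S p hx
  have hsq := Finset.add_sum_erase S q hx
  have hi : Inst (S.erase x) (s(y1, y2) ::ₘ s(y3, y4) ::ₘ R) p q b := by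
    refine ⟨?_, fun v hv => h.p0 v (Finset.mem_of_mem_erase hv),
      fun v hv => h.q0 v (Finset.mem_of_mem_erase hv), ?_, ?_, ?_, ?_⟩
    · intro e he v hv
      rcases Multiset.mem_cons.1 he with rfl | he
      · rcases Sym2.mem_iff.1 hv with rfl | rfl <;> assumption
      rcases Multiset.mem_cons.1 he with rfl | he
      · rcases Sym2.mem_iff.1 hv with rfl | rfl <;> assumption
      exact P.hR e he v hv
    · have := h.sum3
      omega
    · intro A hA
      have hxA : x ∉ A := fun hh => by simpa using hA hh
      have := h.par A (hA.trans (Finset.erase_subset _ _))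
      rw [hdg A hxA]
      split_ifs <;> omega
    · have := h.ii
      simp only [Finset.sum_add_distrib] at this ⊢
      unfold nm at *; omega
    · intro A hA hne hns
      have hxA : x ∉ A := fun hh => by simpa using hA hh
      have hAS : A ⊆ S := hA.trans (Finset.erase_subset _ _)
      have hAnS : A ≠ S := fun hh => hxA (hh ▸ hx)
      rw [hdg A hxA]
      have i3 := h.iii A hAS hne hAnS
      by_cases c1 : y1 ∈ A ∧ y2 ∈ A <;> by_cases c2 : y3 ∈ A ∧ y4 ∈ A
      · have := h.iii (insert x A) (Finset.insert_subset hx hAS) (by simp) (insert_ne hxA hns)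
        rw [dg_insert P _ _ hxA, hcard, hY, Finset.sum_insert hxA] at this
        simp only [c1, c2, if_true, and_self] at this ⊢
        unfold nm at *; omega
      · have := hr A hAS (Finset.one_lt_card.2 ⟨y1, c1.1, y2, c1.2, h12⟩) hAnS
        simp only [c1, c2, if_true, if_false, and_self]
        omega
      · have := hr A hAS (Finset.one_lt_card.2 ⟨y3, c2.1, y4, c2.2, h34⟩) hAnS
        simp only [c1, c2, if_true, if_false, and_self]
        omega
      · simp only [c1, c2, if_false]; omega
  obtain ⟨c, hO, hc⟩ := IH _ _ _ _ _ (Finset.card_erase_lt_of_mem hx) hi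
  have cx : c x = 0 := Orn_supp_S hi.edges hO (by simp)
  have o1 := Orn_lift x y1 y2 hO
  rw [show s(x, y1) ::ₘ s(x, y2) ::ₘ s(y3, y4) ::ₘ R = s(y3, y4) ::ₘ s(x, y1) ::ₘ s(x, y2) ::ₘ R by
    simp only [← Multiset.singleton_add]; abel] at o1
  have o2 := Orn_loops K (fun e he => ⟨x, P.hK e he⟩) (Orn_lift x y3 y4 o1)
  refine ⟨c, ?_, fun v hv => ?_⟩
  · rw [P.hM]
    convert o2 using 1
    rw [Finset.insert_val_of_notMem (by simp [h12, h13, h14]),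
      Finset.insert_val_of_notMem (by simp [h23, h24]),
      Finset.insert_val_of_notMem (by simp [h34])]
    simp only [Finset.singleton_val, Multiset.map_cons, Multiset.map_singleton]
    simp only [← Multiset.singleton_add]
    abel
  · by_cases hvx : v = x
    · subst hvx; omega
    · exact hc v (Finset.mem_erase.2 ⟨hvx, hv⟩)

theorem zero_step1 {S : Finset V} {M : Multiset (Sym2 V)} {p q b : V → ℤ}
    (IH : IHless S) (h : Inst S M p q b) (hr : Roomy S M p q b) {x : V} (hx : x ∈ S)
    {Y : Finset V} {K R : Multiset (Sym2 V)} (P : Pack S M x Y K R)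
    (hb : b x % 6 = 0) (hp : p x = 1) (hq : q x = 0) (hY : Y.card = 3) : Sol S M p q b := by
  obtain ⟨y1, y3, y4, h13, h14, h34, rfl⟩ := Finset.card_eq_three.1 hY
  have hYS := P.hY
  have m1 : y1 ∈ S.erase x := hYS (by simp)
  have m3 : y3 ∈ S.erase x := hYS (by simp)
  have m4 : y4 ∈ S.erase x := hYS (by simp)
  have hcard : ∀ A : Finset V, ((({y1, y3, y4} : Finset V) ∩ A).card : ℤ) =
      (if y1 ∈ A then 1 else 0) + (if y3 ∈ A then 1 else 0) +
      (if y4 ∈ A then 1 else 0) := by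
    intro A
    have := sum_ind A {y1, y3, y4}
    rw [← this]
    rw [Finset.sum_insert (by simp [h13, h14]),
      Finset.sum_insert (by simp [h34]), Finset.sum_singleton]
    simp only [ind]; ring
  have hdg : ∀ A : Finset V, x ∉ A → dg (s(y3, y4) ::ₘ R) (p + dl y1) q A = dg M p q A -
      (if y3 ∈ A ∧ y4 ∈ A then 2 else 0) := by
    intro A hA
    unfold dg
    simp only [Pi.add_apply, Finset.sum_add_distrib, sum_dl]
    rw [P.hA A hA, hcard, cut_cons, cr_mk]
    by_cases a1 : y1 ∈ A <;> by_cases a3 : y3 ∈ A <;>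
      by_cases a4 : y4 ∈ A <;> simp [a1, a3, a4] <;> ring
  have hsb := Finset.add_sum_erase S b hx
  have hsp := Finset.add_sum_erase S p hx
  have hsq := Finset.add_sum_erase S q hx
  have hi : Inst (S.erase x) (s(y3, y4) ::ₘ R) (p + dl y1) q b := by
    refine ⟨?_, fun v hv => ?_,
      fun v hv => h.q0 v (Finset.mem_of_mem_erase hv), ?_, ?_, ?_, ?_⟩
    · intro e he v hv
      rcases Multiset.mem_cons.1 he with rfl | he
      · rcases Sym2.mem_iff.1 hv with rfl | rfl <;> assumption
      exact P.hR e he v hv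
    · have := h.p0 v (Finset.mem_of_mem_erase hv)
      simp only [Pi.add_apply, dl_apply]; split_ifs <;> omega
    · have := h.sum3
      simp only [Pi.add_apply, Finset.sum_add_distrib, sum_dl, m1, if_true]
      omega
    · intro A hA
      have hxA : x ∉ A := fun hh => by simpa using hA hh
      have := h.par A (hA.trans (Finset.erase_subset _ _))
      rw [hdg A hxA]
      split_ifs <;> omega
    · have := h.ii
      simp only [Pi.add_apply, Finset.sum_add_distrib, sum_dl, m1, if_true] at this ⊢
      unfold nm at *; omega
    · intro A hA hne hns
      have hxA : x ∉ A := fun hh => by simpa using hA hh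
      have hAS : A ⊆ S := hA.trans (Finset.erase_subset _ _)
      have hAnS : A ≠ S := fun hh => hxA (hh ▸ hx)
      rw [hdg A hxA]
      have i3 := h.iii A hAS hne hAnS
      by_cases c2 : y3 ∈ A ∧ y4 ∈ A
      · have := hr A hAS (Finset.one_lt_card.2 ⟨y3, c2.1, y4, c2.2, h34⟩) hAnS
        simp only [c2, if_true, and_self]
        omega
      · simp only [c2, if_false]; omega
  obtain ⟨c, hO, hc⟩ := IH _ _ _ _ _ (Finset.card_erase_lt_of_mem hx) hi
  have cx : c x = 0 := Orn_supp_S hi.edges hO (by simp)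
  have o2 := Orn_loops K (fun e he => ⟨x, P.hK e he⟩) (Orn_cons x y1 (Orn_lift x y3 y4 hO))
  refine ⟨c + dl x - dl y1, ?_, fun v hv => ?_⟩
  · rw [P.hM]
    convert o2 using 1
    rw [Finset.insert_val_of_notMem (by simp [h13, h14]),
      Finset.insert_val_of_notMem (by simp [h34])]
    simp only [Finset.singleton_val, Multiset.map_cons, Multiset.map_singleton]
    simp only [← Multiset.singleton_add]
    abel
  · by_cases hvx : v = x
    · subst hvx
      have : v ≠ y1 := fun hh => by rw [← hh] at m1; simp at m1
      simp only [Pi.add_apply, Pi.sub_apply, dl_apply, this, if_true, if_false]; omega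
    · have := hc v (Finset.mem_erase.2 ⟨hvx, hv⟩)
      simp only [Pi.add_apply, Pi.sub_apply] at this ⊢
      rw [dl_apply x, if_neg hvx]
      convert this using 1; ring

theorem Roomy.neg {S : Finset V} {M : Multiset (Sym2 V)} {p q b : V → ℤ}
    (h : Roomy S M p q b) : Roomy S M q p (-b) := by
  intro A hA h2 hns
  have := h A hA h2 hns
  rw [dg_swap]
  simp only [Pi.neg_apply, Finset.sum_neg_distrib, nm_neg]; exact this

theorem zero_step {S : Finset V} {M : Multiset (Sym2 V)} {p q b : V → ℤ}
    (IH : IHless S) (h : Inst S M p q b) (hr : Roomy S M p q b) {x : V} (hx : x ∈ S)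
    {Y : Finset V} {K R : Multiset (Sym2 V)} (P : Pack S M x Y K R) (hS : 3 ≤ S.card)
    (hb : b x % 6 = 0) (ht : dg M p q {x} = 4) : Sol S M p q b := by
  have hce := Finset.card_erase_of_mem hx
  have h1 := hr (S.erase x) (Finset.erase_subset _ _) (by omega)
    (fun hh => by rw [← hh] at hx; simp at hx)
  rw [dg_erase h hx] at h1
  rw [dg_single] at ht
  have h2 := h.ii
  have hsb := Finset.add_sum_erase S b hx
  have hp := h.p0 x hx
  have hq := h.q0 x hx
  have hw : p x + q x ≤ 1 := by unfold nm at *; omega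
  have hc := P.cutx
  by_cases p1 : p x = 1
  · exact zero_step1 IH h hr hx P hb p1 (by omega) (by omega)
  by_cases q1 : q x = 1
  · apply Sol.neg
    refine zero_step1 IH h.neg hr.neg hx P ?_ q1 (by omega) (by omega)
    simp only [Pi.neg_apply]; omega
  · exact zero_step0 IH h hr hx P hb (by omega) (by omega) (by omega)

end ZeroStep

/-! ### The positive case -/

section Positive

variable [DecidableEq V]

/-- Sets that obstruct the deletion of two edges. -/
def Dang (S : Finset V) (M : Multiset (Sym2 V)) (p q b : V → ℤ) (x : V) (A : Finset V) : Prop :=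
  A ⊆ S.erase x ∧ dg M p q A = 6 + nm (∑ v ∈ A, b v) ∧
    ((∑ v ∈ A, b v) % 6 = 0 ∨ (∑ v ∈ A, b v) % 6 = 5)

theorem uncross_arith (d1 d2 di du dx dy b1 b2 bi bx b2' bu w : ℤ) (hw : 0 ≤ w)
    (h1 : d1 = 6 + nm b1) (h2 : d2 = 6 + nm b2) (hb1 : b1 % 6 = 0 ∨ b1 % 6 = 5)
    (hb2 : b2 % 6 = 0 ∨ b2 % 6 = 5)
    (hx : bx + bi = b1) (hy : b2' + bi = b2) (hu : bu + bi = b1 + b2)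
    (li : 6 + nm bi ≤ di ∨ (di = 4 + nm bi ∧ (bi % 6 = 1 ∨ bi % 6 = 2)))
    (lx : 6 + nm bx ≤ dx ∨ (dx = 4 + nm bx ∧ (bx % 6 = 1 ∨ bx % 6 = 2)))
    (ly : 6 + nm b2' ≤ dy ∨ (dy = 4 + nm b2' ∧ (b2' % 6 = 1 ∨ b2' % 6 = 2)))
    (lu : 6 + nm bu ≤ du) (sub : di + du ≤ d1 + d2) (pos : dx + dy + 2 + 2 * w ≤ d1 + d2) :
    du = 6 + nm bu ∧ (bu % 6 = 0 ∨ bu % 6 = 5) := by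
  unfold nm at *
  have : bi % 6 = 0 ∨ bi % 6 = 1 ∨ bi % 6 = 2 ∨ bi % 6 = 3 ∨ bi % 6 = 4 ∨ bi % 6 = 5 := by omega
  have e1 : bx % 6 = (b1 % 6 + 6 - bi % 6) % 6 := by omega
  have e2 : b2' % 6 = (b2 % 6 + 6 - bi % 6) % 6 := by omega
  have e3 : bu % 6 = (b1 % 6 + b2 % 6 + 6 - bi % 6) % 6 := by omega
  clear hx hy hu
  rcases hb1 with hb1 | hb1 <;> rcases hb2 with hb2 | hb2 <;>
    rcases this with hh | hh | hh | hh | hh | hh <;> rw [hb1, hh] at e1 <;> rw [hb2, hh] at e2 <;>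
    rw [hb1, hb2, hh] at e3 <;> rw [e1] at lx <;> rw [e2] at ly <;>
    rw [e3] at lu ⊢ <;> rw [hh] at li <;> rw [hb1] at h1 <;> rw [hb2] at h2 <;> omega

theorem dang_union {S : Finset V} {M : Multiset (Sym2 V)} {p q b : V → ℤ}
    (h : Inst S M p q b) {x : V}
    (low : ∀ B ⊆ S.erase x, B.Nonempty → 6 + nm (∑ v ∈ B, b v) ≤ dg M p q B ∨
      (dg M p q B = 4 + nm (∑ v ∈ B, b v) ∧ ((∑ v ∈ B, b v) % 6 = 1 ∨ (∑ v ∈ B, b v) % 6 = 2)))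
    (low2 : ∀ B ⊆ S.erase x, 2 ≤ B.card → 6 + nm (∑ v ∈ B, b v) ≤ dg M p q B)
    {A B : Finset V} (hA : Dang S M p q b x A) (hB : Dang S M p q b x B) {y : V}
    (hxy : s(x, y) ∈ M) (hyA : y ∈ A) (hyB : y ∈ B) (hAB : (A \ B).Nonempty)
    (hBA : (B \ A).Nonempty) : Dang S M p q b x (A ∪ B) := by
  obtain ⟨hAS, hAd, hAb⟩ := hA
  obtain ⟨hBS, hBd, hBb⟩ := hB
  have hUS : A ∪ B ⊆ S.erase x := Finset.union_subset hAS hBS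
  have hxA : x ∉ A := fun hh => by simpa using hAS hh
  have hxB : x ∉ B := fun hh => by simpa using hBS hh
  have hU2 : 2 ≤ (A ∪ B).card := by
    obtain ⟨u, hu⟩ := hAB
    obtain ⟨v, hv⟩ := hBA
    rw [Finset.mem_sdiff] at hu hv
    exact Finset.one_lt_card.2 ⟨u, by simp [hu.1], v, by simp [hv.1], fun e => hu.2 (e ▸ hv.1)⟩
  have s1 : ∀ f : V → ℤ, ∑ v ∈ A \ B, f v + ∑ v ∈ A ∩ B, f v = ∑ v ∈ A, f v := fun f => by
    rw [add_comm]; exact Finset.sum_inter_add_sum_sdiff A B f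
  have s2 : ∀ f : V → ℤ, ∑ v ∈ B \ A, f v + ∑ v ∈ A ∩ B, f v = ∑ v ∈ B, f v := fun f => by
    rw [add_comm, Finset.inter_comm]; exact Finset.sum_inter_add_sum_sdiff B A f
  have s3 : ∀ f : V → ℤ, ∑ v ∈ A ∪ B, f v + ∑ v ∈ A ∩ B, f v = ∑ v ∈ A, f v + ∑ v ∈ B, f v :=
    fun f => Finset.sum_union_inter
  have w0 : 0 ≤ ∑ v ∈ A ∩ B, (p v + q v) := by
    apply Finset.sum_nonneg
    intro v hv
    have hvS : v ∈ S := Finset.mem_of_mem_erase (hAS (Finset.mem_inter.1 hv).1)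
    have := h.p0 v hvS
    have := h.q0 v hvS
    omega
  have sub : dg M p q (A ∩ B) + dg M p q (A ∪ B) ≤ dg M p q A + dg M p q B := by
    have := cut_submod M A B
    have := s3 (fun v => p v + q v)
    unfold dg; linarith
  have pos : dg M p q (A \ B) + dg M p q (B \ A) + 2 + 2 * ∑ v ∈ A ∩ B, (p v + q v) ≤
      dg M p q A + dg M p q B := by
    have := cut_posimod_edge M A B x y hxy hxA hxB hyA hyB
    have := s1 (fun v => p v + q v)
    have := s2 (fun v => p v + q v)
    unfold dg; linarith
  have key := uncross_arith _ _ _ _ _ _ _ _ _ _ _ _ _ w0 hAd hBd hAb hBb (s1 b) (s2 b) (s3 b)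
    (low _ (inter_subset_left.trans hAS) ⟨y, Finset.mem_inter.2 ⟨hyA, hyB⟩⟩)
    (low _ (sdiff_subset.trans hAS) hAB) (low _ (sdiff_subset.trans hBS) hBA) (low2 _ hUS hU2)
    sub pos
  exact ⟨hUS, key.1, key.2⟩

theorem pos_arith1 (D bS r bx o i d : ℤ) (h3 : 3 ∣ bS + D) (h2 : (0 + D - bS) % 2 = 0)
    (hb : bx % 6 = 1 ∨ bx % 6 = 2) (h5 : D ≤ 5) (hr1 : 1 ≤ r) (hr : r + 4 ≤ D + bx % 6)
    (ho : o = bx % 6 - 1) (hi : i = 2) (hd : d = 3 - r) :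
    D - r - 0 + o + i ≤ 4 + nm (bS - bx - d) := by
  subst ho hi hd
  have e1 : bS % 6 = (-D) % 6 := by omega
  have e2 : (bS - bx - (3 - r)) % 6 = (-D - bx % 6 - (3 - r)) % 6 := by omega
  unfold nm
  rw [e2]
  omega

theorem pos_arith2 (k d B : ℤ) (hk : k = 0 ∨ k = 1) (i3 : 4 + nm B ≤ d)
    (hlow : 6 + nm B ≤ d ∨ (d = 4 + nm B ∧ (B % 6 = 1 ∨ B % 6 = 2))) :
    4 + nm (B - k) ≤ d - k := by
  rcases hk with rfl | rfl <;> unfold nm at * <;> omega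

theorem pos_arith3 (d B : ℤ) (l2 : 6 + nm B ≤ d) (hp : (d - B) % 2 = 0)
    (hn : ¬ (d = 6 + nm B ∧ (B % 6 = 0 ∨ B % 6 = 5))) :
    4 + nm (B - 2) ≤ d - 2 := by
  unfold nm at *; omega

theorem positive_step {S : Finset V} {M : Multiset (Sym2 V)} {p q b : V → ℤ}
    (IH : IHless S) (h : Inst S M p q b) (hr : Roomy S M p q b) {x : V} (hx : x ∈ S)
    {Y : Finset V} {K R : Multiset (Sym2 V)} (P : Pack S M x Y K R) (hS : 3 ≤ S.card)
    (ht : ∀ v ∈ S, dg M p q {v} = 4 + nm (b v)) (hb : ∀ v ∈ S, b v % 6 = 1 ∨ b v % 6 = 2)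
    (hq : ∀ v ∈ S, q v = 0) (hpx : 1 ≤ p x) : Sol S M p q b := by
  classical
  have hce := Finset.card_erase_of_mem hx
  have hne : S.erase x ≠ S := fun hh => by rw [← hh] at hx; simp at hx
  have her := hr (S.erase x) (Finset.erase_subset _ _) (by omega) hne
  have hde := dg_erase h hx
  have htx := ht x hx
  rw [dg_single, P.cutx, hq x hx] at htx
  rw [P.cutx, hq x hx] at hde
  have hbx := hb x hx
  have h2 := h.ii
  have hsb := Finset.add_sum_erase S b hx
  have hq0 : ∑ v ∈ S, q v = 0 := Finset.sum_eq_zero hq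
  have h3 := h.sum3
  have hparS := h.par S (le_refl _)
  have hcS : cut M S = 0 := by
    have := cut_compl M S S h.edges
    rw [← this, Finset.sdiff_self]
    apply cut_eq_zero
    intro e _
    induction e using Sym2.ind with
    | _ u v => simp [cr_mk]
  unfold dg at hparS
  rw [hcS] at hparS
  rw [hq0, sub_zero] at h3
  have hpq : ∑ v ∈ S, (p v + q v) = ∑ v ∈ S, p v := by
    rw [Finset.sum_add_distrib, hq0, add_zero]
  rw [hpq] at h2 hparS hde
  have hple : p x ≤ ∑ v ∈ S, p v := Finset.single_le_sum (f := p) h.p0 hx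
  have hD5 : ∑ v ∈ S, p v ≤ 5 := by unfold nm at h2; omega
  rw [hde] at her
  have hYc : (Y.card : ℤ) = 4 + b x % 6 - p x := by unfold nm at htx; omega
  have hr2 : p x ≤ 2 ∧ p x + 4 ≤ ∑ v ∈ S, p v + b x % 6 := by unfold nm at her; omega
  have hAS : ∀ A ⊆ S.erase x, A ⊆ S ∧ A ≠ S ∧ x ∉ A := by
    intro A hA
    have hxA : x ∉ A := fun hh => by simpa using hA hh
    exact ⟨hA.trans (Finset.erase_subset _ _), fun hh => hxA (hh ▸ hx), hxA⟩
  have low2 : ∀ B ⊆ S.erase x, 2 ≤ B.card → 6 + nm (∑ v ∈ B, b v) ≤ dg M p q B :=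
    fun B hB hB2 => hr B (hAS B hB).1 hB2 (hAS B hB).2.1
  have low : ∀ B ⊆ S.erase x, B.Nonempty → 6 + nm (∑ v ∈ B, b v) ≤ dg M p q B ∨
      (dg M p q B = 4 + nm (∑ v ∈ B, b v) ∧
        ((∑ v ∈ B, b v) % 6 = 1 ∨ (∑ v ∈ B, b v) % 6 = 2)) := by
    intro B hB hBn
    rcases card_cases hBn with ⟨v, rfl⟩ | hc
    · right
      have hv := (hAS _ hB).1 (Finset.mem_singleton_self v)
      rw [Finset.sum_singleton]
      exact ⟨ht v hv, hb v hv⟩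
    · left; exact low2 B hB hc
  have hnd : p x = 1 → ¬ Dang S M p q b x (S.erase x) := by
    rintro hp1 ⟨_, e1, e2⟩
    unfold nm at e1; omega
  -- choice of the deleted edges
  have hDel : ∃ D ⊆ Y, (D.card : ℤ) = 3 - p x ∧ ∀ A, Dang S M p q b x A → (A ∩ D).card ≤ 1 := by
    by_cases hp1 : p x = 1
    · by_contra hcon
      have hall : ∀ y ∈ Y, ∀ y' ∈ Y, y ≠ y' → ∃ A, Dang S M p q b x A ∧ y ∈ A ∧ y' ∈ A := by
        intro y hy y' hy' hyy
        by_contra hno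
        apply hcon
        refine ⟨{y, y'}, ?_, ?_, ?_⟩
        · intro z hz; simp at hz; rcases hz with rfl | rfl <;> assumption
        · rw [Finset.card_pair hyy, hp1]; norm_num
        · intro A hA
          by_contra hc
          apply hno
          have : A ∩ {y, y'} = {y, y'} := by
            apply Finset.eq_of_subset_of_card_le Finset.inter_subset_right
            rw [Finset.card_pair hyy]; omega
          have h1 : y ∈ A ∩ {y, y'} := by rw [this]; simp
          have h2 : y' ∈ A ∩ {y, y'} := by rw [this]; simp
          exact ⟨A, hA, (Finset.mem_inter.1 h1).1, (Finset.mem_inter.1 h2).1⟩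
      obtain ⟨ya, hya, yb, hyb, hab⟩ := Finset.one_lt_card.1 (show 1 < Y.card by omega)
      obtain ⟨A0, hA0, hA0a, hA0b⟩ := hall ya hya yb hyb hab
      obtain ⟨A1, hA1m, hmax⟩ := Finset.exists_max_image
        ((S.erase x).powerset.filter (fun A => Dang S M p q b x A)) (fun A => (Y ∩ A).card)
        ⟨A0, Finset.mem_filter.2 ⟨Finset.mem_powerset.2 hA0.1, hA0⟩⟩
      have hA1 := (Finset.mem_filter.1 hA1m).2
      have hmax' : ∀ A, Dang S M p q b x A → (Y ∩ A).card ≤ (Y ∩ A1).card := fun A hA =>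
        hmax A (Finset.mem_filter.2 ⟨Finset.mem_powerset.2 hA.1, hA⟩)
      have hpos : 0 < (Y ∩ A1).card :=
        lt_of_lt_of_le (Finset.card_pos.2 ⟨ya, Finset.mem_inter.2 ⟨hya, hA0a⟩⟩) (hmax' A0 hA0)
      obtain ⟨y1, hy1⟩ := Finset.card_pos.1 hpos
      rw [Finset.mem_inter] at hy1
      have hx1 := hAS A1 hA1.1
      have hnsub : ¬ Y ⊆ A1 := by
        intro hsub
        have hins := hr (insert x A1) (Finset.insert_subset hx hx1.1) (by
          rw [Finset.card_insert_of_notMem hx1.2.2]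
          have := Finset.card_pos.2 ⟨y1, hy1.2⟩
          omega) (insert_ne hx1.2.2 (fun hh => hnd hp1 (hh ▸ hA1)))
        rw [dg_insert P _ _ hx1.2.2, Finset.inter_eq_left.2 hsub, hA1.2.1, hq x hx] at hins
        have := hA1.2.2
        unfold nm at hins; omega
      obtain ⟨y3, hy3, hy3n⟩ := Finset.not_subset.1 hnsub
      obtain ⟨A2, hA2, h21, h23⟩ := hall y1 hy1.1 y3 hy3 (fun e => hy3n (e ▸ hy1.2))
      have hd1 : (A1 \ A2).Nonempty := by
        by_contra hemp
        rw [Finset.not_nonempty_iff_eq_empty, Finset.sdiff_eq_empty_iff_subset] at hemp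
        have : Y ∩ A1 ⊂ Y ∩ A2 := by
          rw [Finset.ssubset_iff_of_subset (Finset.inter_subset_inter_left hemp)]
          exact ⟨y3, Finset.mem_inter.2 ⟨hy3, h23⟩, fun hh => hy3n (Finset.mem_inter.1 hh).2⟩
        have := Finset.card_lt_card this
        have := hmax' A2 hA2
        omega
      have hU := dang_union h low low2 hA1 hA2 (P.edge hy1.1) hy1.2 h21 hd1
        ⟨y3, Finset.mem_sdiff.2 ⟨h23, hy3n⟩⟩
      have : Y ∩ A1 ⊂ Y ∩ (A1 ∪ A2) := by
        rw [Finset.ssubset_iff_of_subset (Finset.inter_subset_inter_left Finset.subset_union_left)]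
        exact ⟨y3, Finset.mem_inter.2 ⟨hy3, Finset.mem_union_right _ h23⟩,
          fun hh => hy3n (Finset.mem_inter.1 hh).2⟩
      have := Finset.card_lt_card this
      have := hmax' _ hU
      omega
    · obtain ⟨D, hDY, hDc⟩ := Finset.exists_subset_card_eq (show 1 ≤ Y.card by omega)
      refine ⟨D, hDY, by omega, fun A _ => ?_⟩
      calc (A ∩ D).card ≤ D.card := Finset.card_le_card Finset.inter_subset_right
        _ = 1 := hDc
  obtain ⟨D, hDY, hDc, hDd⟩ := hDel
  have hsd := Finset.card_sdiff_add_card_eq_card hDY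
  obtain ⟨I, hIY, hIc⟩ := Finset.exists_subset_card_eq (show 2 ≤ (Y \ D).card by omega)
  have hOc := Finset.card_sdiff_add_card_eq_card hIY
  refine star_contract IH h hx P (O := (Y \ D) \ I) (I := I) (D := D) ?_ ?_ ?_ ?_ ?_ ?_
  · rw [Finset.sdiff_union_of_subset hIY, Finset.sdiff_union_of_subset hDY]
  · exact Finset.sdiff_disjoint
  · rw [Finset.sdiff_union_of_subset hIY]; exact Finset.sdiff_disjoint
  · rw [hq x hx]; omega
  · rw [hpq, hq x hx]
    exact pos_arith1 _ _ _ _ _ _ _ h3 hparS hbx hD5 hpx hr2.2 (by omega) (by omega) hDc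
  · intro A hA hAn hAne
    have hk : (A ∩ D).card ≤ 2 :=
      (Finset.card_le_card Finset.inter_subset_right).trans (by omega)
    have hkA : (A ∩ D).card ≤ A.card := Finset.card_le_card Finset.inter_subset_left
    have hd := hDd A
    have hlow := low A hA hAn
    have i3 := h.iii A (hAS A hA).1 hAn (hAS A hA).2.1
    have hpar := h.par A (hAS A hA).1
    rcases Nat.lt_or_ge (A ∩ D).card 2 with hlt | hge
    · exact pos_arith2 _ _ _ (by omega) i3 hlow
    · have e : (A ∩ D).card = 2 := by omega
      have l2 := low2 A hA (by omega)
      have hnD : ¬ Dang S M p q b x A := fun hh => by have := hd hh; omega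
      have hnD' : ¬ (dg M p q A = 6 + nm (∑ v ∈ A, b v) ∧
        ((∑ v ∈ A, b v) % 6 = 0 ∨ (∑ v ∈ A, b v) % 6 = 5)) := fun hh => hnD ⟨hA, hh.1, hh.2⟩
      rw [e]; push_cast
      exact pos_arith3 _ _ l2 hpar hnD'

end Positive

/-! ### The main orientation theorem -/

section MainOrient

variable [DecidableEq V]

theorem exists_pack {S : Finset V} {M : Multiset (Sym2 V)} {p q b : V → ℤ} (h : Inst S M p q b)
    (hs : Simp M) (x : V) : ∃ Y K R, Pack S M x Y K R := by
  obtain ⟨Y, K, R, h1, h2, h3, h4, h5, h6⟩ := star_pack h.edges hs x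
  exact ⟨Y, K, R, h1, h2, h3, h4, h5, h6⟩

theorem small_step {S : Finset V} {M : Multiset (Sym2 V)} {p q b : V → ℤ}
    (h : Inst S M p q b) (hS : S.card ≤ 1) : Sol S M p q b := by
  have hl : ∀ e ∈ M, ∃ x, e = s(x, x) := by
    intro e he
    have h1 := h.edges e he
    induction e using Sym2.ind with
    | _ u v =>
      have := Finset.card_le_one.1 hS u (h1 u (by simp)) v (h1 v (by simp))
      exact ⟨u, by rw [this]⟩
  refine ⟨0, ?_, fun v hv => ?_⟩
  · simpa using Orn_loops M hl Orn_zero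
  · have hSv : S = {v} := by
      apply Finset.eq_singleton_iff_unique_mem.2
      exact ⟨hv, fun w hw => Finset.card_le_one.1 hS w hw v hv⟩
    have := h.sum3
    rw [hSv] at this
    simp only [Finset.sum_singleton] at this
    simp only [Pi.zero_apply]
    omega

theorem two_step {S : Finset V} {M : Multiset (Sym2 V)} {p q b : V → ℤ}
    (h : Inst S M p q b) (hs : Simp M) (hS : S.card = 2) : False := by
  obtain ⟨x, y, hxy, rfl⟩ := Finset.card_eq_two.1 hS
  obtain ⟨Y, K, R, P⟩ := exists_pack h hs x
  have hYc : Y.card ≤ 1 := by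
    have := Finset.card_le_card P.hY
    rw [Finset.card_erase_of_mem (by simp), hS] at this
    omega
  have d1 := dg_single M p q x
  have d2 := dg_erase h (x := x) (by simp)
  have e : ({x, y} : Finset V).erase x = {y} := by
    ext v; simp only [Finset.mem_erase, Finset.mem_insert, Finset.mem_singleton]
    constructor
    · rintro ⟨h1, h2⟩; tauto
    · rintro rfl; exact ⟨hxy.symm, Or.inr rfl⟩
  rw [e] at d2
  rw [P.cutx] at d1 d2
  have i1 := h.iii {x} (by simp) (by simp) (fun hh => by
    have := congrArg Finset.card hh; rw [hS] at this; simp at this)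
  have i2 := h.iii {y} (by simp) (by simp) (fun hh => by
    have := congrArg Finset.card hh; rw [hS] at this; simp at this)
  have i3 := h.ii
  rw [Finset.sum_pair hxy] at i3
  rw [Finset.sum_pair hxy] at d2
  rw [Finset.sum_pair hxy] at i3
  rw [Finset.sum_singleton] at i1 i2
  unfold nm at *
  omega

theorem arc_facts {S : Finset V} {M : Multiset (Sym2 V)} {p q b : V → ℤ}
    (IH : IHsame S M p q) (h : Inst S M p q b) (hr : Roomy S M p q b) (hno : ¬ Sol S M p q b)
    (hS : 2 ≤ S.card) {x : V} (hx : x ∈ S) (hp : 1 ≤ p x) :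
    dg M p q {x} = 4 + nm (b x) ∧ (b x % 6 = 0 ∨ b x % 6 = 1 ∨ b x % 6 = 2) := by
  have h1 := mt (arc_step IH h hr hx hp) hno
  have i1 := h.iii {x} (by simpa using hx) (by simp) (fun hh => by
    have := congrArg Finset.card hh; simp at this; omega)
  have i2 := h.par {x} (by simpa using hx)
  rw [Finset.sum_singleton] at i1 i2
  unfold nm at *
  omega

theorem IHsame.neg {S : Finset V} {M : Multiset (Sym2 V)} {p q : V → ℤ}
    (IH : IHsame S M p q) : IHsame S M q p := by
  intro M' p' q' b' hlt hi
  refine IH M' p' q' b' ?_ hi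
  have : ∑ v ∈ S, (q v + p v) = ∑ v ∈ S, (p v + q v) :=
    Finset.sum_congr rfl (fun v _ => by ring)
  rw [← this]; exact hlt

theorem tight_all {S : Finset V} {M : Multiset (Sym2 V)} {p q b : V → ℤ}
    (IH : IHsame S M p q) (h : Inst S M p q b) (hr : Roomy S M p q b) (hs : Simp M)
    (hno : ¬ Sol S M p q b) (hS : 2 ≤ S.card) {x : V} (hx : x ∈ S) :
    dg M p q {x} = 4 + nm (b x) ∧ (1 ≤ p x → (b x % 6 = 0 ∨ b x % 6 = 1 ∨ b x % 6 = 2)) ∧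
      (1 ≤ q x → (b x % 6 = 0 ∨ b x % 6 = 4 ∨ b x % 6 = 5)) := by
  have hpf : 1 ≤ p x → _ := arc_facts IH h hr hno hS hx
  have hqf : 1 ≤ q x → _ := arc_facts IH.neg h.neg hr.neg (mt Sol.neg hno) hS hx
  rw [dg_swap] at hqf
  simp only [Pi.neg_apply, nm_neg] at hqf
  have t : dg M p q {x} = 4 + nm (b x) := by
    by_cases hp : 1 ≤ p x
    · exact (hpf hp).1
    by_cases hq : 1 ≤ q x
    · exact (hqf hq).1
    by_contra hnt
    have i1 := h.iii {x} (by simpa using hx) (by simp) (fun hh => by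
      have := congrArg Finset.card hh; simp at this; omega)
    have i2 := h.par {x} (by simpa using hx)
    rw [Finset.sum_singleton] at i1 i2
    have i3 : 6 + nm (b x) ≤ dg M p q {x} := by unfold nm at *; omega
    obtain ⟨Y, K, R, P⟩ := exists_pack h hs x
    have hp0 := h.p0 x hx
    have hq0 := h.q0 x hx
    have hYc : 2 ≤ Y.card := by
      have := dg_single M p q x
      rw [P.cutx] at this
      unfold nm at i3; omega
    obtain ⟨y, hy, w, hw, hyw⟩ := Finset.one_lt_card.1 hYc
    have hyx : y ≠ x := (Finset.mem_erase.1 (P.hY hy)).1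
    have hwx : w ≠ x := (Finset.mem_erase.1 (P.hY hw)).1
    obtain ⟨M1, hM1⟩ := Multiset.exists_cons_of_mem (P.edge hy)
    have hwM : s(x, w) ∈ M1 := by
      have := P.edge hw
      rw [hM1] at this
      rcases Multiset.mem_cons.1 this with e | e
      · exfalso
        rcases Sym2.eq_iff.1 e with ⟨_, e2⟩ | ⟨e1, _⟩
        · exact hyw e2.symm
        · exact hyx e1.symm
      · exact e
    obtain ⟨M2, hM2⟩ := Multiset.exists_cons_of_mem hwM
    rw [hM2] at hM1
    exact hno (lift_step IH h hr hyx hwx hyw hM1 i3)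
  refine ⟨t, fun hp => (hpf hp).2, fun hq => ?_⟩
  have := (hqf hq).2
  omega

theorem no_arcs {S : Finset V} {M : Multiset (Sym2 V)} {p q b : V → ℤ}
    (IH : IHless S) (h : Inst S M p q b) {x : V} (hx : x ∈ S)
    {Y : Finset V} {K R : Multiset (Sym2 V)} (P : Pack S M x Y K R)
    (ht : dg M p q {x} = 4 + nm (b x)) (h0 : ∑ v ∈ S, (p v + q v) = 0) : Sol S M p q b := by
  have hpx := h.p0 x hx
  have hqx := h.q0 x hx
  have hle : p x + q x ≤ ∑ v ∈ S, (p v + q v) :=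
    Finset.single_le_sum (f := fun v => p v + q v)
      (fun v hv => add_nonneg (h.p0 v hv) (h.q0 v hv)) hx
  have hd := dg_single M p q x
  rw [P.cutx] at hd
  have hpx0 : p x = 0 := by omega
  have hqx0 : q x = 0 := by omega
  obtain ⟨k, hk, hk3⟩ : ∃ k : ℕ, k ≤ Y.card ∧ (3 : ℤ) ∣ 2 * k - Y.card - b x := by
    by_cases h3 : b x % 6 ≤ 3
    · refine ⟨2 + (b x % 6).toNat, ?_, ?_⟩ <;> unfold nm at ht <;> omega
    · refine ⟨2, ?_, ?_⟩ <;> unfold nm at ht <;> omega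
  obtain ⟨O, hOY, hOc⟩ := Finset.exists_subset_card_eq hk
  have hsd := Finset.card_sdiff_add_card_eq_card hOY
  have hsum : ∑ v ∈ S, b v - b x = ∑ v ∈ S, b v - b x - 0 := by ring
  refine star_contract IH h hx P (O := O) (I := Y \ O) (D := ∅) ?_ ?_ ?_ ?_ ?_ ?_
  · rw [Finset.union_empty, Finset.union_sdiff_of_subset hOY]
  · exact Finset.disjoint_sdiff
  · simp
  · rw [hpx0, hqx0]; simp only [Finset.card_empty]; omega
  · have hcS : cut M S = 0 := by
      have := cut_compl M S S h.edges
      rw [← this, Finset.sdiff_self]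
      apply cut_eq_zero
      intro e _
      induction e using Sym2.ind with
      | _ u v => simp [cr_mk]
    have h3 := h.sum3
    have h2 := h.par S (le_refl _)
    unfold dg at h2
    rw [hcS, h0] at h2
    have hps : ∑ v ∈ S, p v = 0 := by
      have h1 := Finset.sum_nonneg h.p0
      have h2 := Finset.sum_nonneg h.q0
      rw [Finset.sum_add_distrib] at h0; omega
    have hqs : ∑ v ∈ S, q v = 0 := by
      rw [Finset.sum_add_distrib] at h0; omega
    rw [h0, hpx0, hqx0]
    simp only [Finset.card_empty]
    unfold nm at *; omega
  · intro A hA hAn hAne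
    have hxA : x ∉ A := fun hh => by simpa using hA hh
    have := h.iii A (hA.trans (Finset.erase_subset _ _)) hAn (fun hh => hxA (hh ▸ hx))
    simpa using this

theorem orient_aux [Fintype V] {S : Finset V} {M : Multiset (Sym2 V)} {p q b : V → ℤ}
    (IH1 : IHless S) (IH2 : IHsame S M p q) (h : Inst S M p q b) : Sol S M p q b := by
  by_contra hno
  have hS2 : 2 ≤ S.card := by
    by_contra hc; exact hno (small_step h (by omega))
  have hr : Roomy S M p q b := by
    intro A hA hA2 hAS
    by_contra hc
    exact hno (tight_step IH1 h hA hA2 hAS (by omega))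
  have hs : Simp M := by
    intro x y hxy
    by_contra hc
    have hm : s(x, y) ∈ M := by
      rw [← Multiset.count_pos]; omega
    exact hno (parallel_step IH1 h (h.edges _ hm x (by simp)) (h.edges _ hm y (by simp)) hxy
      (by omega))
  have hS3 : 3 ≤ S.card := by
    by_contra hc; exact two_step h hs (by omega)
  have tight := fun x (hx : x ∈ S) => tight_all IH2 h hr hs hno hS2 hx
  have hnz : ∀ x ∈ S, b x % 6 ≠ 0 := by
    intro x hx h0
    obtain ⟨Y, K, R, P⟩ := exists_pack h hs x
    refine hno (zero_step IH1 h hr hx P hS3 h0 ?_)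
    have := (tight x hx).1
    unfold nm at this; omega
  have hw : ∑ v ∈ S, (p v + q v) ≠ 0 := by
    intro h0
    obtain ⟨x, hx⟩ := Finset.card_pos.1 (show 0 < S.card by omega)
    obtain ⟨Y, K, R, P⟩ := exists_pack h hs x
    exact hno (no_arcs IH1 h hx P (tight x hx).1 h0)
  have hdel : ∀ x y, y ≠ x → s(x, y) ∈ M → ¬ ((1 ≤ b x % 6 ∧ b x % 6 ≤ 3) ∧ 3 ≤ b y % 6) :=
    fun x y hxy hm hh => hno (delete_step IH2 h hr hxy hm hh.1 hh.2)
  have hn3 : ∀ x ∈ S, b x % 6 ≠ 3 := by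
    intro x hx h3
    obtain ⟨Y, K, R, P⟩ := exists_pack h hs x
    have ht := tight x hx
    have hd := dg_single M p q x
    rw [P.cutx] at hd
    have := h.p0 x hx
    have := h.q0 x hx
    have hYc : 0 < Y.card := by
      have := ht.1
      unfold nm at this; omega
    obtain ⟨y, hy⟩ := Finset.card_pos.1 hYc
    have hyx := (Finset.mem_erase.1 (P.hY hy))
    have hm := P.edge hy
    have := hnz y hyx.2
    have c1 := hdel x y hyx.1 hm
    have c2 := hdel y x (Ne.symm hyx.1) (by rw [Sym2.eq_swap]; exact hm)
    omega
  obtain ⟨x, hx, hwx⟩ := Finset.exists_ne_zero_of_sum_ne_zero hw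
  obtain ⟨Y, K, R, P⟩ := exists_pack h hs x
  by_cases hP : ∀ v ∈ S, b v % 6 = 1 ∨ b v % 6 = 2
  · have hq : ∀ v ∈ S, q v = 0 := by
      intro v hv
      have := hP v hv
      have := (tight v hv).2.2
      have := h.q0 v hv
      omega
    have := h.p0 x hx
    have := hq x hx
    exact hno (positive_step IH1 h hr hx P hS3 (fun v hv => (tight v hv).1) hP hq (by omega))
  by_cases hN : ∀ v ∈ S, b v % 6 = 4 ∨ b v % 6 = 5
  · have hp : ∀ v ∈ S, p v = 0 := by
      intro v hv
      have := hN v hv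
      have := (tight v hv).2.1
      have := h.p0 v hv
      omega
    have := h.q0 x hx
    have := hp x hx
    refine hno (Sol.neg (positive_step IH1 h.neg hr.neg hx P hS3 ?_ ?_ hp (by omega)))
    · intro v hv
      rw [dg_swap, Pi.neg_apply, nm_neg]
      exact (tight v hv).1
    · intro v hv
      have := hN v hv
      rw [Pi.neg_apply]; omega
  push Not at hP hN
  obtain ⟨u, hu, hu1⟩ := hP
  obtain ⟨v, hv, hv1⟩ := hN
  set A := S.filter (fun w => b w % 6 ≤ 2) with hA
  have hAS : A ⊆ S := Finset.filter_subset _ _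
  have hvA : v ∈ A := by
    rw [hA, Finset.mem_filter]
    have := hnz v hv
    have := hn3 v hv
    exact ⟨hv, by omega⟩
  have huA : u ∉ A := by
    rw [hA, Finset.mem_filter]
    have := hnz u hu
    rintro ⟨_, h2⟩; omega
  have hcut : cut M A = 0 := by
    apply cut_eq_zero
    intro e he
    have hS := h.edges e he
    induction e using Sym2.ind with
    | _ a c =>
      have ha := hS a (by simp)
      have hc := hS c (by simp)
      rw [cr_mk]
      rw [if_pos]
      by_contra hcon
      have hac : a ≠ c := by rintro rfl; exact hcon Iff.rfl
      have c1 := hdel a c hac.symm he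
      have c2 := hdel c a hac (by rw [Sym2.eq_swap]; exact he)
      have := hnz a ha
      have := hnz c hc
      simp only [hA, Finset.mem_filter, ha, hc, true_and] at hcon
      omega
  have i1 := h.iii A hAS ⟨v, hvA⟩ (fun hh => huA (hh ▸ hu))
  have i2 := h.iii (S \ A) Finset.sdiff_subset ⟨u, Finset.mem_sdiff.2 ⟨hu, huA⟩⟩
    (fun hh => by rw [← hh] at hv; exact (Finset.mem_sdiff.1 hv).2 hvA)
  unfold dg at i1 i2
  rw [cut_compl M S A h.edges, hcut] at i2
  rw [hcut] at i1
  have i3 := h.ii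
  have i4 := Finset.sum_sdiff hAS (f := fun v => p v + q v)
  unfold nm at *
  omega

theorem orient [Fintype V] : ∀ (n : ℕ) (S : Finset V), S.card = n → ∀ (m : ℕ)
    (M : Multiset (Sym2 V)) (p q b : V → ℤ),
    ((M.card : ℤ) + ∑ v ∈ S, (p v + q v)).toNat = m → Inst S M p q b → Sol S M p q b := by
  intro n
  induction n using Nat.strong_induction_on with
  | _ n ihn =>
    intro S hS m
    induction m using Nat.strong_induction_on with
    | _ m ihm =>
      intro M p q b hm h
      refine orient_aux ?_ ?_ h
      · intro S' M' p' q' b' hlt hi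
        exact ihn S'.card (hS ▸ hlt) S' rfl _ M' p' q' b' rfl hi
      · intro M' p' q' b' hlt hi
        refine ihm _ ?_ M' p' q' b' rfl hi
        have : 0 ≤ ∑ v ∈ S, (p' v + q' v) :=
          Finset.sum_nonneg (fun v hv => add_nonneg (hi.p0 v hv) (hi.q0 v hv))
        omega

end MainOrient

/-! ### Balanced orientations and equitable colourings -/

section Balanced

theorem balanced {W : Type*} [DecidableEq W] : ∀ (n : ℕ) (M : Multiset (Sym2 W)), M.card = n →
    ∃ c, Orn M c ∧ ∀ w, -1 ≤ c w ∧ c w ≤ 1 := by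
  intro n
  induction n using Nat.strong_induction_on with
  | _ n ih =>
    intro M hM
    rcases Multiset.empty_or_exists_mem M with rfl | ⟨e, he⟩
    · exact ⟨0, Orn_zero, fun w => by simp⟩
    obtain ⟨M0, rfl⟩ := Multiset.exists_cons_of_mem he
    rw [Multiset.card_cons] at hM
    induction e using Sym2.ind with
    | _ u v =>
      by_cases huv : u = v
      · subst huv
        obtain ⟨c, h1, h2⟩ := ih _ (by omega) M0 rfl
        exact ⟨c, Orn_loop u h1, h2⟩
      have hlift : ∀ a b : W, (∃ e ∈ M0, a ∈ e) →
          ∃ c, Orn (s(a, b) ::ₘ M0) c ∧ ∀ w, -1 ≤ c w ∧ c w ≤ 1 := by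
        rintro a b ⟨e, he, hae⟩
        obtain ⟨w, rfl⟩ := Sym2.mem_iff_exists.1 hae
        obtain ⟨M1, rfl⟩ := Multiset.exists_cons_of_mem he
        obtain ⟨c, h1, h2⟩ := ih (M1.card + 1) (by rw [Multiset.card_cons] at hM; omega)
          (s(b, w) ::ₘ M1) (by simp)
        exact ⟨c, Orn_lift a b w h1, h2⟩
      by_cases hu : ∃ e ∈ M0, u ∈ e
      · exact hlift u v hu
      by_cases hv : ∃ e ∈ M0, v ∈ e
      · rw [Sym2.eq_swap]; exact hlift v u hv
      push Not at hu hv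
      obtain ⟨c, h1, h2⟩ := ih _ (by omega) M0 rfl
      have cu := Orn_supp h1 hu
      have cv := Orn_supp h1 hv
      refine ⟨_, Orn_cons u v h1, fun w => ?_⟩
      have := h2 w
      simp only [Pi.add_apply, Pi.sub_apply, dl_apply]
      by_cases e1 : w = u
      · subst e1; simp [huv, cu]
      · by_cases e2 : w = v
        · subst e2; simp [e1, cv]
        · simp [e1, e2, this]

theorem extract {W : Type*} [DecidableEq W] [DecidableEq E] (f : E → W × W) (F : Finset E) :
    ∀ {c : W → ℤ}, Orn (F.val.map (fun e => s((f e).1, (f e).2))) c →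
    ∃ σ : E → Bool, ∀ w, c w = ∑ e ∈ F, (if σ e then dl (f e).1 w - dl (f e).2 w
      else dl (f e).2 w - dl (f e).1 w) := by
  induction F using Finset.induction_on with
  | empty =>
    intro c h
    have : c = 0 := (Orn_zero_iff c).1 (by simpa using h)
    exact ⟨fun _ => true, fun w => by simp [this]⟩
  | insert a F ha ih =>
    intro c h
    rw [Finset.insert_val_of_notMem ha, Multiset.map_cons] at h
    obtain ⟨c0, h0, hc⟩ := (Orn_cons_iff _ _).1 h
    obtain ⟨σ, hσ⟩ := ih h0
    have key : ∀ t : Bool, ∀ w, ∑ e ∈ insert a F, (if (Function.update σ a t) e = true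
        then dl (f e).1 w - dl (f e).2 w else dl (f e).2 w - dl (f e).1 w) =
        (if t then dl (f a).1 w - dl (f a).2 w else dl (f a).2 w - dl (f a).1 w) + c0 w := by
      intro t w
      rw [Finset.sum_insert ha, hσ w, Function.update_self]
      congr 1
      apply Finset.sum_congr rfl
      intro e he
      have hne : e ≠ a := fun hh => ha (hh ▸ he)
      rw [Function.update_of_ne hne]
    rcases hc with rfl | rfl
    · refine ⟨Function.update σ a true, fun w => ?_⟩
      rw [key]; simp only [Pi.add_apply, Pi.sub_apply, if_true]; ring
    · refine ⟨Function.update σ a false, fun w => ?_⟩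
      rw [key]; simp only [Pi.add_apply, Pi.sub_apply]
      rw [if_neg (by simp)]; ring

/-- Incidence of an arc with a vertex of the bipartite double cover. -/
def bi [DecidableEq V] (T H : E → V) (e : E) : V ⊕ V → ℤ
  | .inl v => dl (T e) v
  | .inr v => dl (H e) v

theorem split_two [DecidableEq V] [DecidableEq E] (T H : E → V) (F : Finset E) :
    ∃ σ : E → Bool, ∀ w, -1 ≤ ∑ e ∈ F, (if σ e then bi T H e w else - bi T H e w) ∧
      ∑ e ∈ F, (if σ e then bi T H e w else - bi T H e w) ≤ 1 := by
  obtain ⟨c, hO, hc⟩ := balanced _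
    (F.val.map (fun e => s((Sum.inl (T e) : V ⊕ V), (Sum.inr (H e) : V ⊕ V)))) rfl
  obtain ⟨σ, hσ⟩ := extract (fun e => ((Sum.inl (T e) : V ⊕ V), (Sum.inr (H e) : V ⊕ V))) F hO
  refine ⟨σ, fun w => ?_⟩
  have h1 := hc w
  rw [hσ w] at h1
  dsimp only at h1
  cases w with
  | inl v =>
    have e : ∑ e ∈ F, (if σ e then bi T H e (.inl v) else - bi T H e (.inl v)) = _ :=
      Finset.sum_congr rfl (g := fun e => if σ e = true then
        dl (Sum.inl (T e) : V ⊕ V) (.inl v) - dl (Sum.inr (H e) : V ⊕ V) (.inl v)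
      else dl (Sum.inr (H e) : V ⊕ V) (.inl v) - dl (Sum.inl (T e) : V ⊕ V) (.inl v)) (by
        intro e _
        simp [bi, dl_apply])
    rw [e]; exact h1
  | inr v =>
    have e : ∑ e ∈ F, (if σ e then bi T H e (.inr v) else - bi T H e (.inr v)) = _ :=
      Finset.sum_congr rfl (g := fun e => - if σ e = true then
        dl (Sum.inl (T e) : V ⊕ V) (.inr v) - dl (Sum.inr (H e) : V ⊕ V) (.inr v)
      else dl (Sum.inr (H e) : V ⊕ V) (.inr v) - dl (Sum.inl (T e) : V ⊕ V) (.inr v)) (by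
        intro e _
        by_cases hs : σ e <;> simp [bi, dl_apply, hs])
    rw [e, Finset.sum_neg_distrib]
    omega

/-- Degree of `w` in colour `i`. -/
def cdeg [Fintype E] [DecidableEq V] (T H : E → V) (χ : E → Fin 3) (i : Fin 3) (w : V ⊕ V) : ℤ :=
  ∑ e ∈ univ.filter (fun e => χ e = i), bi T H e w

theorem sq_arith {a b a' b' : ℤ} (h : a' + b' = a + b) (h1 : -1 ≤ a' - b') (h2 : a' - b' ≤ 1) :
    a' ^ 2 + b' ^ 2 ≤ a ^ 2 + b ^ 2 ∧ (2 ≤ a - b → a' ^ 2 + b' ^ 2 < a ^ 2 + b ^ 2) := by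
  have hc : a' - b' = -1 ∨ a' - b' = 0 ∨ a' - b' = 1 := by omega
  have e1 : 2 * (a' ^ 2 + b' ^ 2) = (a' + b') ^ 2 + (a' - b') ^ 2 := by ring
  have e2 : 2 * (a ^ 2 + b ^ 2) = (a' + b') ^ 2 + (a - b) ^ 2 := by rw [h]; ring
  have e3 : (a' - b') ^ 2 ≤ (a - b) ^ 2 := by
    rcases hc with hc | hc | hc
    · rw [hc]; have : a - b ≠ 0 := by omega
      have := Int.one_le_abs this
      nlinarith [sq_abs (a - b)]
    · rw [hc]; nlinarith [sq_nonneg (a - b)]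
    · rw [hc]; have : a - b ≠ 0 := by omega
      have := Int.one_le_abs this
      nlinarith [sq_abs (a - b)]
  refine ⟨by linarith, fun h3 => ?_⟩
  have e4 : (a' - b') ^ 2 ≤ 1 := by rcases hc with hc | hc | hc <;> rw [hc] <;> norm_num
  nlinarith

theorem equitable [Fintype V] [Fintype E] [DecidableEq V] (T H : E → V) :
    ∃ χ : E → Fin 3, ∀ i j w, cdeg T H χ i w - cdeg T H χ j w ≤ 1 := by
  classical
  obtain ⟨χ, -, hmin⟩ := Finset.exists_min_image (univ : Finset (E → Fin 3))
    (fun χ => ∑ w : V ⊕ V, ∑ i, cdeg T H χ i w ^ 2) ⟨fun _ => 0, mem_univ _⟩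
  refine ⟨χ, ?_⟩
  by_contra hcon
  push Not at hcon
  obtain ⟨i, j, w, hw⟩ := hcon
  have hij : i ≠ j := by rintro rfl; simp at hw
  obtain ⟨σ, hσ⟩ := split_two T H (univ.filter (fun e => χ e = i ∨ χ e = j))
  let χ' : E → Fin 3 := fun e => if χ e = i ∨ χ e = j then (if σ e then i else j) else χ e
  have hχ' : ∀ e, χ' e = if χ e = i ∨ χ e = j then (if σ e then i else j) else χ e := fun e => rfl
  have hk : ∀ k, k ≠ i → k ≠ j → ∀ w, cdeg T H χ' k w = cdeg T H χ k w := by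
    intro k hki hkj w
    unfold cdeg
    congr 1
    ext e
    simp only [mem_filter, mem_univ, true_and, hχ']
    by_cases h1 : χ e = i
    · by_cases h2 : σ e <;> simp [h1, h2, hki.symm, hkj.symm]
    · by_cases h3 : χ e = j
      · by_cases h2 : σ e <;> simp [h3, h2, hki.symm, hkj.symm]
      · simp [h1, h3]
  have hsum : ∀ w, cdeg T H χ' i w + cdeg T H χ' j w = cdeg T H χ i w + cdeg T H χ j w := by
    intro w
    simp only [cdeg, Finset.sum_filter, ← Finset.sum_add_distrib]
    apply Finset.sum_congr rfl
    intro e _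
    simp only [hχ']
    by_cases h1 : χ e = i
    · by_cases h2 : σ e <;> simp [h1, h2, hij, hij.symm]
    · by_cases h3 : χ e = j
      · by_cases h2 : σ e <;> simp [h3, h2, hij, hij.symm]
      · simp [h1, h3]
  have hdiff : ∀ w, cdeg T H χ' i w - cdeg T H χ' j w =
      ∑ e ∈ univ.filter (fun e => χ e = i ∨ χ e = j), (if σ e then bi T H e w else - bi T H e w) := by
    intro w
    simp only [cdeg, Finset.sum_filter, ← Finset.sum_sub_distrib]
    apply Finset.sum_congr rfl
    intro e _
    simp only [hχ']
    by_cases h1 : χ e = i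
    · by_cases h2 : σ e <;> simp [h1, h2, hij, hij.symm]
    · by_cases h3 : χ e = j
      · by_cases h2 : σ e <;> simp [h3, h2, hij, hij.symm]
      · simp [h1, h3]
  have hsplit : ∀ (f : Fin 3 → ℤ), ∑ k, f k = (f i + f j) + ∑ k ∈ (univ.erase i).erase j, f k := by
    intro f
    rw [← Finset.add_sum_erase univ f (mem_univ i),
      ← Finset.add_sum_erase (univ.erase i) f (mem_erase.2 ⟨hij.symm, mem_univ j⟩)]
    ring
  have hrest : ∀ w, ∑ k ∈ (univ.erase i).erase j, cdeg T H χ' k w ^ 2 =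
      ∑ k ∈ (univ.erase i).erase j, cdeg T H χ k w ^ 2 := by
    intro w
    apply Finset.sum_congr rfl
    intro k hk'
    simp only [mem_erase, mem_univ, and_true] at hk'
    rw [hk k hk'.2 hk'.1]
  have hlt : ∑ w : V ⊕ V, ∑ i, cdeg T H χ' i w ^ 2 < ∑ w : V ⊕ V, ∑ i, cdeg T H χ i w ^ 2 := by
    apply Finset.sum_lt_sum
    · intro w _
      have h1 := hσ w
      rw [← hdiff] at h1
      have := (sq_arith (hsum w) h1.1 h1.2).1
      rw [hsplit, hsplit (fun i => cdeg T H χ i w ^ 2), hrest]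
      linarith
    · refine ⟨w, mem_univ w, ?_⟩
      have h1 := hσ w
      rw [← hdiff] at h1
      have := (sq_arith (hsum w) h1.1 h1.2).2 (by omega)
      rw [hsplit, hsplit (fun i => cdeg T H χ i w ^ 2), hrest]
      linarith
  exact absurd (hmin χ' (mem_univ _)) (not_le.2 hlt)

end Balanced

/-! ### The factorization theorem -/

section Final

theorem mdeg_sum [DecidableEq V] (ends : E → V × V) (S : Finset E) (v : V) :
    (mdeg ends S v : ℤ) = ∑ e ∈ S, (dl (ends e).1 v + dl (ends e).2 v) := by
  unfold mdeg
  push_cast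
  rw [Finset.sum_add_distrib]
  simp only [dl_apply, eq_comm (a := v)]
  simp

theorem mdeg_colors [Fintype E] [DecidableEq V] (ends : E → V × V) (c : E → Fin 3) (v : V) :
    ∑ i : Fin 3, (mdeg ends (univ.filter fun e => c e = i) v : ℤ) = mdeg ends univ v := by
  simp only [mdeg_sum]
  exact Finset.sum_fiberwise univ c _

theorem mdeg_total [Fintype V] [DecidableEq V] (ends : E → V × V) (S : Finset E) :
    ∑ v : V, (mdeg ends S v : ℤ) = 2 * S.card := by
  simp only [mdeg_sum]
  rw [Finset.sum_comm]
  simp only [Finset.sum_add_distrib, sum_dl, mem_univ, if_true]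
  simp; ring

theorem real_iff (a d : ℕ) : |(a : ℝ) - (d : ℝ) / 3| < 1 ↔
    (-2 ≤ 3 * (a : ℤ) - d ∧ 3 * (a : ℤ) - d ≤ 2) := by
  rw [abs_lt]
  constructor
  · rintro ⟨h1, h2⟩
    have h3 : (-3 : ℝ) < 3 * a - d := by linarith
    have h4 : (3 * a - d : ℝ) < 3 := by linarith
    have h5 : (-3 : ℤ) < 3 * a - d := by exact_mod_cast h3
    have h6 : (3 * a - d : ℤ) < 3 := by exact_mod_cast h4
    omega
  · rintro ⟨h1, h2⟩
    have h3 : (-2 : ℝ) ≤ 3 * a - d := by exact_mod_cast h1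
    have h4 : (3 * a - d : ℝ) ≤ 2 := by exact_mod_cast h2
    constructor <;> linarith

theorem forward [Fintype V] [Fintype E] [DecidableEq V] (ends : E → V × V) (c : E → Fin 3)
    (hc : ∀ v : V, ∀ i : Fin 3,
        |((mdeg ends (univ.filter fun e => c e = i) v : ℝ)) -
          (mdeg ends univ v : ℝ) / 3| < 1) :
      (univ.filter fun v : V => ¬ (3 ∣ mdeg ends univ v)).card ≠ 1 := by
  intro h1
  obtain ⟨v, hv⟩ := Finset.card_eq_one.1 h1
  simp only [real_iff] at hc
  have hvm : ¬ 3 ∣ mdeg ends univ v := by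
    have : v ∈ univ.filter fun v : V => ¬ (3 ∣ mdeg ends univ v) := by rw [hv]; simp
    exact (mem_filter.1 this).2
  have hu : ∀ u, u ≠ v → 3 ∣ mdeg ends univ u := by
    intro u huv
    by_contra hh
    have : u ∈ univ.filter fun v : V => ¬ (3 ∣ mdeg ends univ v) := by simp [hh]
    rw [hv] at this
    exact huv (by simpa using this)
  have key : ∀ i, (mdeg ends (univ.filter fun e => c e = i) v : ℤ) +
      ∑ u ∈ univ.erase v, (mdeg ends univ u : ℤ) / 3 =
      2 * (univ.filter fun e => c e = i).card := by
    intro i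
    rw [← mdeg_total ends (univ.filter fun e => c e = i), ← Finset.add_sum_erase univ _ (mem_univ v)]
    congr 1
    apply Finset.sum_congr rfl
    intro u hu'
    have h2 := hu u (mem_erase.1 hu').1
    have h3 := hc u i
    omega
  have k0 := key 0
  have k1 := key 1
  have k2 := key 2
  have c0 := hc v 0
  have c1 := hc v 1
  have c2 := hc v 2
  have hs := mdeg_colors ends c v
  rw [Fin.sum_univ_three] at hs
  have e01 : (mdeg ends (univ.filter fun e => c e = 0) v : ℤ) =
      mdeg ends (univ.filter fun e => c e = 1) v := by clear hs k2 c2; omega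
  have e02 : (mdeg ends (univ.filter fun e => c e = 0) v : ℤ) =
      mdeg ends (univ.filter fun e => c e = 2) v := by clear hs k1 c1 e01; omega
  clear k0 k1 k2 c0 c1 c2
  omega

theorem cut_cutCard [Fintype E] [DecidableEq V] (ends : E → V × V) (A : Finset V) :
    cut ((univ : Finset E).val.map (fun e => s((ends e).1, (ends e).2))) A = cutCard ends A := by
  unfold cut cutCard
  rw [Multiset.map_map]
  change ∑ e : E, cr A s((ends e).1, (ends e).2) = _
  rw [Finset.card_filter]
  push_cast
  apply Finset.sum_congr rfl
  intro e _
  rw [cr_mk]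
  by_cases h1 : (ends e).1 ∈ A <;> by_cases h2 : (ends e).2 ∈ A <;> simp [h1, h2]

theorem cut_parity [Fintype E] [DecidableEq V] (ends : E → V × V) (A : Finset V) :
    (2 : ℤ) ∣ ∑ v ∈ A, (mdeg ends univ v : ℤ) - cutCard ends A := by
  rw [← cut_cutCard]
  unfold cut
  rw [Multiset.map_map]
  change (2 : ℤ) ∣ _ - ∑ e : E, cr A s((ends e).1, (ends e).2)
  simp only [mdeg_sum]
  rw [Finset.sum_comm, ← Finset.sum_sub_distrib]
  apply Finset.dvd_sum
  intro e _
  rw [cr_mk, Finset.sum_add_distrib, sum_dl, sum_dl]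
  by_cases h1 : (ends e).1 ∈ A <;> by_cases h2 : (ends e).2 ∈ A <;> simp [h1, h2]

theorem signs [Fintype V] (d : V → ℕ)
    (hk : (univ.filter fun v : V => ¬ (3 ∣ d v)).card ≠ 1) :
    ∃ b : V → ℤ, (∀ v, b v = d v ∨ b v = - d v) ∧ (3 : ℤ) ∣ ∑ v, b v := by
  classical
  set N := univ.filter fun v : V => ¬ (3 ∣ d v) with hN
  obtain ⟨B, hBN, hBc⟩ := Finset.exists_subset_card_eq (show (2 * N.card) % 3 ≤ N.card by omega)
  have hch : ∀ v, ∃ β : ℤ, (β = d v ∨ β = - d v) ∧ (3 : ℤ) ∣ β - (ind N v - 2 * ind B v) := by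
    intro v
    by_cases hv : v ∈ N
    · have h3 : ¬ 3 ∣ d v := (mem_filter.1 hv).2
      have hm : d v % 3 = 1 ∨ d v % 3 = 2 := by omega
      by_cases hB : v ∈ B <;> simp only [ind, hv, hB, if_true, if_false] <;> rcases hm with hm | hm
      · exact ⟨_, Or.inr rfl, by omega⟩
      · exact ⟨_, Or.inl rfl, by omega⟩
      · exact ⟨_, Or.inl rfl, by omega⟩
      · exact ⟨_, Or.inr rfl, by omega⟩
    · have h3 : 3 ∣ d v := by
        by_contra hh; exact hv (by simp [hN, hh])
      have hB : v ∉ B := fun hh => hv (hBN hh)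
      simp only [ind, hv, hB, if_false]
      exact ⟨_, Or.inl rfl, by omega⟩
  choose b hb1 hb2 using hch
  refine ⟨b, hb1, ?_⟩
  have h1 : (3 : ℤ) ∣ ∑ v, (b v - (ind N v - 2 * ind B v)) := Finset.dvd_sum (fun v _ => hb2 v)
  rw [Finset.sum_sub_distrib, Finset.sum_sub_distrib, ← Finset.mul_sum, sum_ind, sum_ind,
    Finset.univ_inter, Finset.univ_inter] at h1
  omega

theorem good_orientation [Fintype V] [Fintype E] [DecidableEq V] (ends : E → V × V)
    (hconn : EdgeConn ends 6)
    (hk : (univ.filter fun v : V => ¬ (3 ∣ mdeg ends univ v)).card ≠ 1) :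
    ∃ T H : E → V, (∀ e v, dl (T e) v + dl (H e) v = dl (ends e).1 v + dl (ends e).2 v) ∧
      ∀ v, (3 : ℤ) ∣ ∑ e, dl (T e) v ∨ (3 : ℤ) ∣ ∑ e, dl (H e) v := by
  classical
  obtain ⟨b, hb, hb3⟩ := signs (fun v => mdeg ends univ v) hk
  set M := (univ : Finset E).val.map (fun e => s((ends e).1, (ends e).2)) with hM
  have hpar : ∀ A : Finset V, ((cutCard ends A : ℤ) - ∑ v ∈ A, b v) % 2 = 0 := by
    intro A
    have h1 := cut_parity ends A
    have h2 : (2 : ℤ) ∣ ∑ v ∈ A, ((mdeg ends univ v : ℤ) - b v) :=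
      Finset.dvd_sum (fun v _ => by rcases hb v with e | e <;> rw [e] <;> omega)
    rw [Finset.sum_sub_distrib] at h2
    omega
  have hdg : ∀ A, dg M 0 0 A = cutCard ends A := by
    intro A; unfold dg; rw [hM, cut_cutCard]; simp
  have hi : Inst univ M 0 0 b := by
    refine ⟨fun _ _ v _ => mem_univ v, by simp, by simp, by simpa using hb3, ?_, ?_, ?_⟩
    · intro A _
      rw [hdg]; exact hpar A
    · simp only [Pi.zero_apply, add_zero, Finset.sum_const_zero]
      unfold nm; omega
    · intro A _ hne hnu
      rw [hdg]
      have h1 := hconn A hne hnu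
      have h2 := hpar A
      unfold nm; omega
  obtain ⟨c, hO, hc⟩ := orient _ univ rfl _ M 0 0 b rfl hi
  obtain ⟨σ, hσ⟩ := extract ends univ hO
  refine ⟨fun e => if σ e then (ends e).1 else (ends e).2,
    fun e => if σ e then (ends e).2 else (ends e).1, ?_, ?_⟩
  · intro e v
    by_cases hs : σ e <;> simp [hs]; ring
  · intro v
    have h1 := hc v (mem_univ v)
    have h2 : c v = ∑ e, dl (if σ e then (ends e).1 else (ends e).2) v -
        ∑ e, dl (if σ e then (ends e).2 else (ends e).1) v := by
      rw [hσ v, ← Finset.sum_sub_distrib]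
      apply Finset.sum_congr rfl
      intro e _
      by_cases hs : σ e <;> simp [hs]
    have h3 : (mdeg ends univ v : ℤ) = ∑ e, dl (if σ e then (ends e).1 else (ends e).2) v +
        ∑ e, dl (if σ e then (ends e).2 else (ends e).1) v := by
      rw [mdeg_sum, ← Finset.sum_add_distrib]
      apply Finset.sum_congr rfl
      intro e _
      by_cases hs : σ e <;> simp [hs]; ring
    have h4 := hb v
    simp only [Pi.zero_apply] at h1
    beta_reduce at h4 ⊢
    rcases h4 with h4 | h4 <;> omega

theorem backward [Fintype V] [Fintype E] [DecidableEq V] (ends : E → V × V)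
    (hconn : EdgeConn ends 6)
    (hk : (univ.filter fun v : V => ¬ (3 ∣ mdeg ends univ v)).card ≠ 1) :
    ∃ c : E → Fin 3, ∀ v : V, ∀ i : Fin 3,
        |((mdeg ends (univ.filter fun e => c e = i) v : ℝ)) -
          (mdeg ends univ v : ℝ) / 3| < 1 := by
  obtain ⟨T, H, hTH, h3⟩ := good_orientation ends hconn hk
  obtain ⟨χ, hχ⟩ := equitable T H
  refine ⟨χ, fun v i => ?_⟩
  rw [real_iff]
  have hdeg : ∀ i, (mdeg ends (univ.filter fun e => χ e = i) v : ℤ) =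
      cdeg T H χ i (.inl v) + cdeg T H χ i (.inr v) := by
    intro i
    rw [mdeg_sum, cdeg, cdeg, ← Finset.sum_add_distrib]
    apply Finset.sum_congr rfl
    intro e _
    rw [← hTH]; rfl
  have hT : ∑ e, dl (T e) v = ∑ i, cdeg T H χ i (.inl v) :=
    (Finset.sum_fiberwise univ χ (fun e => dl (T e) v)).symm
  have hH : ∑ e, dl (H e) v = ∑ i, cdeg T H χ i (.inr v) :=
    (Finset.sum_fiberwise univ χ (fun e => dl (H e) v)).symm
  have hs := mdeg_colors ends χ v
  have h3v := h3 v
  rw [hT, hH] at h3v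
  rw [Fin.sum_univ_three] at hs
  rw [Fin.sum_univ_three, Fin.sum_univ_three] at h3v
  have a1 := hχ 0 1 (.inl v)
  have a2 := hχ 1 0 (.inl v)
  have a3 := hχ 0 2 (.inl v)
  have a4 := hχ 2 0 (.inl v)
  have a5 := hχ 1 2 (.inl v)
  have a6 := hχ 2 1 (.inl v)
  have b1 := hχ 0 1 (.inr v)
  have b2 := hχ 1 0 (.inr v)
  have b3 := hχ 0 2 (.inr v)
  have b4 := hχ 2 0 (.inr v)
  have b5 := hχ 1 2 (.inr v)
  have b6 := hχ 2 1 (.inr v)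
  have d0 := hdeg 0
  have d1 := hdeg 1
  have d2 := hdeg 2
  have hi : (mdeg ends (univ.filter fun e => χ e = i) v : ℤ) =
      (mdeg ends (univ.filter fun e => χ e = 0) v : ℤ) ∨
      (mdeg ends (univ.filter fun e => χ e = i) v : ℤ) =
      (mdeg ends (univ.filter fun e => χ e = 1) v : ℤ) ∨
      (mdeg ends (univ.filter fun e => χ e = i) v : ℤ) =
      (mdeg ends (univ.filter fun e => χ e = 2) v : ℤ) := by
    have : i = 0 ∨ i = 1 ∨ i = 2 := by fin_cases i <;> simp
    rcases this with rfl | rfl | rfl <;> simp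
  omega

end Final

/-- A `6`-edge-connected multigraph has a `3`-equitable factorization iff it does not
have exactly one vertex of degree not divisible by `3`. -/
theorem equitable_three_factorization_iff [Fintype V] [Fintype E] [DecidableEq V]
    (ends : E → V × V) (hconn : EdgeConn ends 6) :
    (∃ c : E → Fin 3, ∀ v : V, ∀ i : Fin 3,
        |((mdeg ends (univ.filter fun e => c e = i) v : ℝ)) -
          (mdeg ends univ v : ℝ) / 3| < 1) ↔
      (univ.filter fun v : V => ¬ (3 ∣ mdeg ends univ v)).card ≠ 1 :=
  ⟨fun ⟨c, hc⟩ => forward ends c hc, fun hk => backward ends hconn hk⟩
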